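/- arXiv:1006.2523 — 2 statements merged into one kernel-verified Lean document; each statement's English description precedes it below -/
import Mathlib

section
/- Let X be an irreducible, critical multitype Galton–Watson tree with finite type space 𝒳 and bounded offspring kernel ℚ, and let ℙ_n be its law conditioned to have exactly n vertices. Then for every ε > 0, lim_{n→∞} ℙ_n{ | −(1/n)·log P_n(X) + Σ_{(a,c)∈𝒳×𝒳*} π(a)·ℚ{c|a}·log ℚ{c|a} | ≥ ε } = 0, where P_n(x) = ℙ_n{X = x}. -/
open Filter

noncomputable section

/-- Finite rooted planar trees with vertices typed by `𝒳`. -/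
inductive GWTree (𝒳 : Type) : Type where
  | node : 𝒳 → List (GWTree 𝒳) → GWTree 𝒳

namespace GWTree

variable {𝒳 : Type}

/-- The type of the root. -/
def root : GWTree 𝒳 → 𝒳
  | node a _ => a

/-- The number of vertices. -/
def size : GWTree 𝒳 → ℕ
  | node _ ts => 1 + (ts.attach.map (fun x => size x.1)).sum
decreasing_by
  have := List.sizeOf_lt_of_mem x.2
  simp only [GWTree.node.sizeOf_spec]
  omega

/-- The product over all vertices `v` of `ℚ{C(v) | type(v)}`. -/
def wt (Q : 𝒳 → List 𝒳 → ℝ) : GWTree 𝒳 → ℝ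
  | node a ts => Q a (ts.map root) * (ts.attach.map (fun x => wt Q x.1)).prod
decreasing_by
  have := List.sizeOf_lt_of_mem x.2
  simp only [GWTree.node.sizeOf_spec]
  omega

/-- The list over all vertices `v` of the pair (type of `v`, types of the children of `v`,
ordered from left to right). -/
def data : GWTree 𝒳 → List (𝒳 × List 𝒳)
  | node a ts => (a, ts.map root) :: (ts.attach.map (fun x => data x.1)).flatten
decreasing_by
  have := List.sizeOf_lt_of_mem x.2
  simp only [GWTree.node.sizeOf_spec]
  omega

end GWTree

/-- Total weight of multitype Galton–Watson trees with exactly `n` vertices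
(initial law `μ`, offspring kernel `Q`). -/
def Zn {𝒳 : Type} (μ : 𝒳 → ℝ) (Q : 𝒳 → List 𝒳 → ℝ) (n : ℕ) : ℝ :=
  ∑' t : GWTree 𝒳, if t.size = n then μ t.root * GWTree.wt Q t else 0

open Classical in
/-- `ℙ_n(S)`: probability of the event `S` under the law of the multitype Galton–Watson tree
conditioned to have exactly `n` vertices. -/
def condPr {𝒳 : Type} (μ : 𝒳 → ℝ) (Q : 𝒳 → List 𝒳 → ℝ) (n : ℕ) (S : Set (GWTree 𝒳)) : ℝ :=
  (∑' t : GWTree 𝒳, if t.size = n ∧ t ∈ S then μ t.root * GWTree.wt Q t else 0) / Zn μ Q n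

/-- The mean offspring matrix `A(a,b) = Σ_c ℚ{c|b} m(a,c)`. -/
def gwA {𝒳 : Type} [Fintype 𝒳] [DecidableEq 𝒳] (Q : 𝒳 → List 𝒳 → ℝ) : Matrix 𝒳 𝒳 ℝ :=
  fun a b => ∑' c : List 𝒳, Q b c * (c.count a : ℝ)

/-- The empirical offspring measure `M_x` of a typed tree `x`. -/
def empOff {𝒳 : Type} [DecidableEq 𝒳] (t : GWTree 𝒳) (ac : 𝒳 × List 𝒳) : ℝ :=
  (t.data.count ac : ℝ) / (t.size : ℝ)

namespace GWTree

variable {𝒳 : Type}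

open scoped ENNReal

theorem size_node (a : 𝒳) (ts : List (GWTree 𝒳)) :
    size (node a ts) = 1 + (ts.map size).sum := by
  rw [size, List.attach_map_val]

theorem wt_node (Q : 𝒳 → List 𝒳 → ℝ) (a : 𝒳) (ts : List (GWTree 𝒳)) :
    wt Q (node a ts) = Q a (ts.map root) * (ts.map (wt Q)).prod := by
  rw [wt, List.attach_map_val]

theorem data_node (a : 𝒳) (ts : List (GWTree 𝒳)) :
    data (node a ts) = (a, ts.map root) :: (ts.map data).flatten := by
  rw [data, List.attach_map_val]

theorem induction_on {P : GWTree 𝒳 → Prop}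
    (h : ∀ a ts, (∀ t ∈ ts, P t) → P (node a ts)) : ∀ t, P t
  | node a ts => h a ts fun t _ => induction_on h t

theorem data_length (t : GWTree 𝒳) : t.data.length = t.size := by
  induction t using induction_on with
  | h a ts ih =>
    rw [data_node, size_node, List.length_cons, List.length_flatten, List.map_map, add_comm]
    congr 2
    exact List.map_congr_left ih

theorem wt_eq_prod (Q : 𝒳 → List 𝒳 → ℝ) (t : GWTree 𝒳) :
    wt Q t = (t.data.map fun x => Q x.1 x.2).prod := by
  induction t using induction_on with
  | h a ts ih =>
    rw [data_node, wt_node, List.map_cons, List.prod_cons, List.map_flatten, List.prod_flatten,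
      List.map_map, List.map_map]
    congr 2
    exact List.map_congr_left ih

/-- The product over all vertices of an extended nonnegative weight. -/
def ewt (q : 𝒳 → List 𝒳 → ℝ≥0∞) (t : GWTree 𝒳) : ℝ≥0∞ :=
  (t.data.map fun x => q x.1 x.2).prod

theorem ewt_node (q : 𝒳 → List 𝒳 → ℝ≥0∞) (a : 𝒳) (ts : List (GWTree 𝒳)) :
    ewt q (node a ts) = q a (ts.map root) * (ts.map (ewt q)).prod := by
  rw [ewt, data_node, List.map_cons, List.prod_cons, List.map_flatten, List.prod_flatten,
    List.map_map, List.map_map]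
  rfl

theorem prod_map_ofReal {α : Type*} (f : α → ℝ) (hf : ∀ x, 0 ≤ f x) (l : List α) :
    (l.map fun x => ENNReal.ofReal (f x)).prod = ENNReal.ofReal (l.map f).prod := by
  induction l with
  | nil => simp
  | cons x l ih => simp [ih, ENNReal.ofReal_mul (hf x)]

theorem ewt_ofReal (Q : 𝒳 → List 𝒳 → ℝ) (hQ0 : ∀ a c, 0 ≤ Q a c) (t : GWTree 𝒳) :
    ewt (fun a c => ENNReal.ofReal (Q a c)) t = ENNReal.ofReal (wt Q t) := by
  rw [wt_eq_prod, ewt, prod_map_ofReal (fun x : 𝒳 × List 𝒳 => Q x.1 x.2) fun x => hQ0 _ _]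

theorem ewt_const_mul (q : 𝒳 → List 𝒳 → ℝ≥0∞) (z : ℝ≥0∞) (t : GWTree 𝒳) :
    ewt (fun a c => z * q a c) t = z ^ t.size * ewt q t := by
  rw [ewt, ewt, List.prod_map_mul, List.map_const', List.prod_replicate, data_length]

theorem tsum_list {α : Type*} (f : List α → ℝ≥0∞) :
    ∑' l, f l = f [] + ∑' (x : α) (l : List α), f (x :: l) := by
  let e : Unit ⊕ (α × List α) ≃ List α :=
    { toFun := fun o => o.elim (fun _ => []) fun p => p.1 :: p.2
      invFun := fun l => match l with
        | [] => Sum.inl ()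
        | x :: l => Sum.inr (x, l)
      left_inv := by rintro (_ | ⟨x, l⟩) <;> rfl
      right_inv := by rintro (_ | ⟨x, l⟩) <;> rfl }
  rw [← e.tsum_eq, Summable.tsum_sum ENNReal.summable ENNReal.summable,
    ENNReal.tsum_prod', tsum_fintype]
  simp [e]

theorem tsum_list_label {α β : Type*} [DecidableEq β] (r : α → β) (h : α → ℝ≥0∞) (c : List β) :
    (∑' l : List α, if l.map r = c then (l.map h).prod else 0)
      = (c.map fun b => ∑' x, if r x = b then h x else 0).prod := by
  induction c with
  | nil =>
    rw [tsum_list]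
    simp
  | cons b c ih =>
    rw [tsum_list, List.map_cons, List.prod_cons, ← ih, ← ENNReal.tsum_mul_right]
    simp only [List.map_nil, List.map_cons, List.cons.injEq, List.prod_cons, reduceCtorEq, if_false,
      zero_add]
    refine tsum_congr fun x => ?_
    rw [← ENNReal.tsum_mul_left]
    refine tsum_congr fun l => ?_
    by_cases h1 : r x = b <;> by_cases h2 : l.map r = c <;> simp [h1, h2]

open Classical in
theorem tsum_list_root (q : List 𝒳 → ℝ≥0∞) (h : GWTree 𝒳 → ℝ≥0∞) :
    ∑' ts : List (GWTree 𝒳), q (ts.map root) * (ts.map h).prod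
      = ∑' c, q c * (c.map fun b => ∑' t, if root t = b then h t else 0).prod := by
  simp only [← tsum_list_label, ← ENNReal.tsum_mul_left]
  rw [ENNReal.tsum_comm]
  refine tsum_congr fun ts => ?_
  rw [tsum_eq_single (ts.map root)]
  · simp
  · intro c hc
    simp [hc.symm]

open Classical in
theorem tsum_root_eq (f : GWTree 𝒳 → ℝ≥0∞) (a : 𝒳) :
    (∑' t, if root t = a then f t else 0) = ∑' ts, f (node a ts) := by
  let e : 𝒳 × List (GWTree 𝒳) ≃ GWTree 𝒳 :=
    { toFun := fun p => node p.1 p.2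
      invFun := fun t => match t with
        | node a ts => (a, ts)
      left_inv := by rintro ⟨a, ts⟩; rfl
      right_inv := by rintro ⟨a, ts⟩; rfl }
  rw [← e.tsum_eq, ENNReal.tsum_prod', tsum_eq_single a]
  · exact tsum_congr fun ts => if_pos rfl
  · intro b hb
    rw [ENNReal.tsum_eq_zero]
    exact fun ts => if_neg hb

open Classical in
/-- Total weight of the trees with root of type `a`. -/
def totalWt (q : 𝒳 → List 𝒳 → ℝ≥0∞) (a : 𝒳) : ℝ≥0∞ :=
  ∑' t, if root t = a then ewt q t else 0

open Classical in
/-- Total weight of the trees of size `n` with root of type `a`. -/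
def sizeWt (q : 𝒳 → List 𝒳 → ℝ≥0∞) (a : 𝒳) (n : ℕ) : ℝ≥0∞ :=
  ∑' t, if root t = a ∧ size t = n then ewt q t else 0

theorem totalWt_eq (q : 𝒳 → List 𝒳 → ℝ≥0∞) (a : 𝒳) :
    totalWt q a = ∑' c, q a c * (c.map (totalWt q)).prod := by
  rw [totalWt, tsum_root_eq]
  simp only [ewt_node]
  exact tsum_list_root _ _

theorem sizeWt_le_totalWt (q : 𝒳 → List 𝒳 → ℝ≥0∞) (a : 𝒳) (n : ℕ) :
    sizeWt q a n ≤ totalWt q a := by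
  refine ENNReal.tsum_le_tsum fun t => ?_
  split_ifs <;> simp_all

theorem totalWt_const_mul (q : 𝒳 → List 𝒳 → ℝ≥0∞) (z : ℝ≥0∞) (a : 𝒳) :
    totalWt (fun a c => z * q a c) a = ∑' n, z ^ n * sizeWt q a n := by
  simp only [totalWt, sizeWt, ← ENNReal.tsum_mul_left, ewt_const_mul]
  rw [ENNReal.tsum_comm]
  refine tsum_congr fun t => ?_
  rw [tsum_eq_single t.size]
  · by_cases h : root t = a <;> simp [h]
  · intro n hn
    simp [hn.symm]

theorem exists_sizeWt_pos {q : 𝒳 → List 𝒳 → ℝ≥0∞} {a : 𝒳} (h : totalWt q a ≠ 0) :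
    ∃ n, sizeWt q a n ≠ 0 := by
  by_contra! h0
  have := totalWt_const_mul q 1 a
  simp [h0] at this
  exact h this

theorem le_sizeWt (q : 𝒳 → List 𝒳 → ℝ≥0∞) (a : 𝒳) (cs : List (𝒳 × ℕ)) :
    q a (cs.map Prod.fst) * (cs.map fun x => sizeWt q x.1 x.2).prod
      ≤ sizeWt q a (1 + (cs.map Prod.snd).sum) := by
  classical
  have h1 : (cs.map fun x => sizeWt q x.1 x.2).prod = ∑' ts : List (GWTree 𝒳),
      if ts.map (fun t => (root t, size t)) = cs then (ts.map (ewt q)).prod else 0 := by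
    refine Eq.trans ?_
      (tsum_list_label (fun t : GWTree 𝒳 => (root t, size t)) (ewt q) cs).symm
    congr 2
    funext b
    exact tsum_congr fun t => by simp [Prod.ext_iff]
  have h3 : sizeWt q a (1 + (cs.map Prod.snd).sum) = ∑' t : GWTree 𝒳, if root t = a then
      (if size t = 1 + (cs.map Prod.snd).sum then ewt q t else 0) else 0 := by
    unfold sizeWt
    refine tsum_congr fun t => ?_
    rw [ite_and]
  rw [h1, ← ENNReal.tsum_mul_left, h3, tsum_root_eq]
  refine ENNReal.tsum_le_tsum fun ts => ?_
  by_cases h : ts.map (fun t => (root t, size t)) = cs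
  · subst h
    have h4 : List.map Prod.fst (ts.map (fun t => (root t, size t))) = ts.map root := by
      simp
    have h5 : List.map Prod.snd (ts.map (fun t => (root t, size t))) = ts.map size := by
      simp
    rw [h4, h5, if_pos rfl, if_pos (size_node _ _), ewt_node]
  · simp [h]

theorem totalWt_le_of_supersolution {q : 𝒳 → List 𝒳 → ℝ≥0∞} {u : 𝒳 → ℝ≥0∞}
    (hu : ∀ a, ∑' c, q a c * (c.map u).prod ≤ u a) (a : 𝒳) : totalWt q a ≤ u a := by
  classical
  have key : ∀ k a, (∑' t : GWTree 𝒳, if root t = a then (if size t ≤ k then ewt q t else 0)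
      else 0) ≤ u a := by
    intro k
    induction k with
    | zero =>
      intro a
      rw [tsum_root_eq]
      simp [size_node]
    | succ k ih =>
      intro a
      rw [tsum_root_eq]
      calc _ ≤ ∑' ts : List (GWTree 𝒳), q a (ts.map root)
            * (ts.map fun t => if size t ≤ k then ewt q t else 0).prod := by
            refine ENNReal.tsum_le_tsum fun ts => ?_
            split_ifs with h
            · rw [ewt_node]
              refine le_of_eq ?_
              congr 2
              refine List.map_congr_left fun t ht => ?_
              rw [if_pos]
              rw [size_node] at h
              have := List.single_le_sum (l := ts.map size) (by simp) (size t)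
                (List.mem_map_of_mem ht)
              omega
            · simp
        _ ≤ ∑' c, q a c * (c.map u).prod := by
            rw [tsum_list_root]
            refine ENNReal.tsum_le_tsum fun c => ?_
            gcongr
            exact List.Forall₂.prod_le_prod' (by
              simp only [List.forall₂_map_left_iff, List.forall₂_map_right_iff]
              exact List.forall₂_same.2 fun b _ => ih b)
        _ ≤ u a := hu a
  rw [totalWt, ENNReal.tsum_eq_iSup_sum]
  refine iSup_le fun s => ?_
  refine le_trans ?_ (key (s.sup size) a)
  refine le_trans ?_ (ENNReal.sum_le_tsum s)
  refine Finset.sum_le_sum fun t ht => ?_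
  rw [if_pos (Finset.le_sup (f := size) ht)]

end GWTree

section Matrix

variable {ι : Type*} [Fintype ι] [DecidableEq ι] {A : Matrix ι ι ℝ}

theorem forall_of_irreducible (hA : ∀ a b, 0 ≤ A a b)
    (hirr : ∀ a b, ∃ k : ℕ, 0 < k ∧ 0 < (A ^ k) a b) {P : ι → Prop} {a : ι} (ha : P a)
    (hstep : ∀ a d, 0 < A d a → P a → P d) (d : ι) : P d := by
  obtain ⟨k, -, hk⟩ := hirr d a
  induction k generalizing d with
  | zero =>
    rw [pow_zero] at hk
    by_cases h : d = a
    · exact h ▸ ha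
    · simp [Matrix.one_apply_ne h] at hk
  | succ k ih =>
    rw [pow_succ', Matrix.mul_apply] at hk
    obtain ⟨e, -, he⟩ := Finset.exists_ne_zero_of_sum_ne_zero hk.ne'
    have h1 : 0 < A d e := (hA d e).lt_of_ne' (left_ne_zero_of_mul he)
    have h2 : 0 ≤ (A ^ k) e a := by
      clear hk ih he h1
      induction k generalizing e with
      | zero => rw [pow_zero, Matrix.one_apply]; split_ifs <;> simp
      | succ k ih =>
        rw [pow_succ', Matrix.mul_apply]
        exact Finset.sum_nonneg fun f _ => mul_nonneg (hA _ _) (ih f)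
    exact hstep e d h1 (ih e (h2.lt_of_ne' (right_ne_zero_of_mul he)))

theorem eigenvector_pos (hA : ∀ a b, 0 ≤ A a b)
    (hirr : ∀ a b, ∃ k : ℕ, 0 < k ∧ 0 < (A ^ k) a b) {w : ι → ℝ} (hw : ∀ a, 0 ≤ w a)
    (hAw : ∀ a, ∑ b, A a b * w b = w a) {a : ι} (ha : 0 < w a) (b : ι) : 0 < w b := by
  refine forall_of_irreducible hA hirr (P := fun b => 0 < w b) ha (fun a d hda ha => ?_) b
  rw [← hAw d]
  exact Finset.sum_pos' (fun e _ => mul_nonneg (hA _ _) (hw e))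
    ⟨a, Finset.mem_univ a, mul_pos hda ha⟩

theorem eigenvector_unique [Nonempty ι] (hA : ∀ a b, 0 ≤ A a b)
    (hirr : ∀ a b, ∃ k : ℕ, 0 < k ∧ 0 < (A ^ k) a b) {p : ι → ℝ} (hp : ∀ a, 0 < p a)
    (hAp : ∀ a, ∑ b, A a b * p b = p a) {y : ι → ℝ} (hy : ∀ a, ∑ b, A a b * y b = y a) :
    ∃ s : ℝ, ∀ a, y a = s * p a := by
  obtain ⟨a₀, -, h0⟩ := Finset.exists_min_image Finset.univ (fun a => y a / p a)
    Finset.univ_nonempty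
  refine ⟨y a₀ / p a₀, fun a => ?_⟩
  by_contra hne
  have hw : ∀ b, 0 ≤ y b - y a₀ / p a₀ * p b := fun b => by
    have := h0 b (Finset.mem_univ b)
    rw [le_div_iff₀ (hp b)] at this
    linarith
  have := eigenvector_pos hA hirr hw (fun b => by
    simp only [mul_sub, Finset.sum_sub_distrib, hy, mul_left_comm _ (y a₀ / p a₀),
      ← Finset.mul_sum, hAp]) (a := a) ((hw a).lt_of_ne' (sub_ne_zero.2 hne)) a₀
  rw [div_mul_cancel₀ _ (hp a₀).ne', sub_self] at this
  exact this.false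

theorem exists_transpose_solution [Nonempty ι] (hA : ∀ a b, 0 ≤ A a b)
    (hirr : ∀ a b, ∃ k : ℕ, 0 < k ∧ 0 < (A ^ k) a b) {p : ι → ℝ} (hp : ∀ a, 0 < p a)
    (hAp : ∀ a, ∑ b, A a b * p b = p a) {g : ι → ℝ} (hg : ∑ a, p a * g a = 0) :
    ∃ v : ι → ℝ, ∀ a, v a - ∑ b, A b a * v b = g a := by
  let f : (ι → ℝ) →ₗ[ℝ] (ι → ℝ) := LinearMap.id - A.mulVecLin
  let φ : Module.Dual ℝ (ι → ℝ) := ∑ a, g a • LinearMap.proj a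
  have hφ : ∀ y, φ y = ∑ a, g a * y a := fun y => by simp [φ]
  have hmem : φ ∈ LinearMap.range f.dualMap := by
    rw [LinearMap.range_dualMap_eq_dualAnnihilator_ker, Submodule.mem_dualAnnihilator]
    intro y hy
    have hy' : ∀ a, ∑ b, A a b * y b = y a := fun a => by
      have := congrFun (LinearMap.mem_ker.1 hy) a
      simp only [f, LinearMap.sub_apply, LinearMap.id_apply, Matrix.mulVecLin_apply,
        Pi.sub_apply, Pi.zero_apply, Matrix.mulVec, dotProduct] at this
      linarith
    obtain ⟨s, hs⟩ := eigenvector_unique hA hirr hp hAp hy'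
    rw [hφ]
    calc ∑ a, g a * y a = s * ∑ a, p a * g a := by
          rw [Finset.mul_sum]
          exact Finset.sum_congr rfl fun a _ => by rw [hs]; ring
      _ = 0 := by rw [hg, mul_zero]
  obtain ⟨ψ, hψ⟩ := hmem
  refine ⟨fun a => ψ (Pi.single a 1), fun a => ?_⟩
  have h1 := LinearMap.congr_fun hψ (Pi.single a 1)
  have h2 : f (Pi.single a 1) = Pi.single a 1 - ∑ b, A b a • Pi.single b (1 : ℝ) := by
    ext d
    simp [f, Pi.single_apply, Finset.sum_apply]
  rw [LinearMap.dualMap_apply, h2, hφ] at h1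
  simpa [Pi.single_apply] using h1

end Matrix

section Kernel

variable {𝒳 : Type} [Fintype 𝒳] [DecidableEq 𝒳]

theorem sum_count_mul (x : 𝒳 → ℝ) (c : List 𝒳) :
    ∑ b, (c.count b : ℝ) * x b = (c.map x).sum := by
  induction c with
  | nil => simp
  | cons d c ih =>
    simp only [List.count_cons, List.map_cons, List.sum_cons, ← ih, Nat.cast_add, add_mul,
      Finset.sum_add_distrib]
    simp [add_comm]

/-- An irreducible critical offspring kernel supported on a finite set of configurations, with
positive mean eigenvector `p` and at least one type that may be childless. -/
structure IsCriticalKernel (Q : 𝒳 → List 𝒳 → ℝ) (S : Finset (List 𝒳)) (p : 𝒳 → ℝ) : Prop where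
  nonneg : ∀ a c, 0 ≤ Q a c
  support : ∀ a c, c ∉ S → Q a c = 0
  sum_eq_one : ∀ a, ∑ c ∈ S, Q a c = 1
  irreducible : ∀ a b, ∃ k : ℕ, 0 < k ∧ 0 < (gwA Q ^ k) a b
  pos : ∀ a, 0 < p a
  sum_p : ∑ a, p a = 1
  critical : ∀ a, ∑ b, gwA Q a b * p b = p a
  childless : ∃ a, 0 < Q a []

namespace IsCriticalKernel

variable {Q : 𝒳 → List 𝒳 → ℝ} {S : Finset (List 𝒳)} {p : 𝒳 → ℝ}

theorem gwA_eq_sum (hS : ∀ a c, c ∉ S → Q a c = 0) (a b : 𝒳) :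
    gwA Q a b = ∑ c ∈ S, Q b c * (c.count a : ℝ) :=
  tsum_eq_sum fun c hc => by rw [hS b c hc, zero_mul]

theorem sum_gwA_mul (hS : ∀ a c, c ∉ S → Q a c = 0) (x : 𝒳 → ℝ) (a : 𝒳) :
    ∑ b, gwA Q b a * x b = ∑ c ∈ S, Q a c * (c.map x).sum := by
  simp only [gwA_eq_sum hS, Finset.sum_mul, ← sum_count_mul, Finset.mul_sum]
  rw [Finset.sum_comm]
  simp only [mul_assoc]

theorem gwA_nonneg (hQ0 : ∀ a c, 0 ≤ Q a c) (a b : 𝒳) : 0 ≤ gwA Q a b :=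
  tsum_nonneg fun _ => mul_nonneg (hQ0 _ _) (Nat.cast_nonneg _)

variable (h : IsCriticalKernel Q S p)
include h

theorem mem_of_pos {a : 𝒳} {c : List 𝒳} (hc : 0 < Q a c) : c ∈ S := by
  by_contra hS
  exact hc.ne' (h.support a c hS)

theorem exists_of_gwA_pos {a d : 𝒳} (hA : 0 < gwA Q d a) : ∃ c, 0 < Q a c ∧ d ∈ c := by
  rw [gwA_eq_sum h.support] at hA
  obtain ⟨c, -, hc⟩ := Finset.exists_ne_zero_of_sum_ne_zero hA.ne'
  refine ⟨c, (h.nonneg a c).lt_of_ne' (left_ne_zero_of_mul hc), ?_⟩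
  by_contra hd
  exact hc (by simp [List.count_eq_zero_of_not_mem hd])

theorem forall_of_step {P : 𝒳 → Prop} {a : 𝒳} (ha : P a)
    (hstep : ∀ a c d, 0 < Q a c → d ∈ c → P a → P d) (d : 𝒳) : P d :=
  forall_of_irreducible (gwA_nonneg h.nonneg) h.irreducible ha (fun a d hda ha => by
    obtain ⟨c, hc, hd⟩ := h.exists_of_gwA_pos hda
    exact hstep a c d hc hd ha) d

theorem sum_p_mul_sum (x : 𝒳 → ℝ) :
    ∑ a, p a * ∑ c ∈ S, Q a c * (c.map x).sum = ∑ a, p a * x a := by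
  simp only [← sum_gwA_mul h.support, Finset.mul_sum]
  rw [Finset.sum_comm]
  refine Finset.sum_congr rfl fun b _ => ?_
  conv_rhs => rw [← h.critical b, Finset.sum_mul]
  exact Finset.sum_congr rfl fun a _ => by ring

/-- Some type has at least two children with positive probability. -/
theorem exists_branching : ∃ a d₁ d₂ c, 0 < Q a (d₁ :: d₂ :: c) := by
  by_contra! hno
  have hlen : ∀ a c, Q a c * (c.map fun _ : 𝒳 => (1 : ℝ)).sum ≤ Q a c := by
    rintro a (_ | ⟨d₁, _ | ⟨d₂, c⟩⟩)
    · simpa using h.nonneg a _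
    · simp
    · rw [(hno a d₁ d₂ c).antisymm (h.nonneg _ _), zero_mul]
  obtain ⟨a₀, ha₀⟩ := h.childless
  have := h.sum_p_mul_sum fun _ => 1
  have hlt : ∑ a, p a * ∑ c ∈ S, Q a c * (c.map fun _ : 𝒳 => (1 : ℝ)).sum
      < ∑ a, p a * 1 := by
    refine Finset.sum_lt_sum (fun a _ => ?_) ⟨a₀, Finset.mem_univ _, ?_⟩
    · refine mul_le_mul_of_nonneg_left ?_ (h.pos a).le
      exact (Finset.sum_le_sum fun c _ => hlen a c).trans_eq (h.sum_eq_one a)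
    · refine mul_lt_mul_of_pos_left ?_ (h.pos a₀)
      exact (Finset.sum_lt_sum (fun c _ => hlen a₀ c)
        ⟨[], h.mem_of_pos ha₀, by simpa using ha₀⟩).trans_eq (h.sum_eq_one a₀)
  exact hlt.ne this





open GWTree
open scoped ENNReal

omit [Fintype 𝒳] [DecidableEq 𝒳] h in
theorem tsum_ofReal_mul (hQ0 : ∀ a c, 0 ≤ Q a c) (hS : ∀ a c, c ∉ S → Q a c = 0)
    {u : 𝒳 → ℝ} (hu : ∀ b, 0 ≤ u b) (a : 𝒳) :
    ∑' c, ENNReal.ofReal (Q a c) * (c.map fun b => ENNReal.ofReal (u b)).prod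
      = ENNReal.ofReal (∑ c ∈ S, Q a c * (c.map u).prod) := by
  have hprod : ∀ c : List 𝒳, 0 ≤ (c.map u).prod := fun c =>
    List.prod_nonneg fun x hx => by
      obtain ⟨b, -, rfl⟩ := List.mem_map.1 hx
      exact hu b
  rw [tsum_eq_sum (s := S) fun c hc => by simp [hS a c hc],
    ENNReal.ofReal_sum_of_nonneg fun c _ => mul_nonneg (hQ0 _ _) (hprod c)]
  exact Finset.sum_congr rfl fun c _ => by
    rw [ENNReal.ofReal_mul (hQ0 _ _), prod_map_ofReal u hu]

omit [Fintype 𝒳] [DecidableEq 𝒳] h in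
/-- A finite total weight satisfies the branching recursion in the reals. -/
theorem toReal_totalWt_eq (hQ0 : ∀ a c, 0 ≤ Q a c) (hS : ∀ a c, c ∉ S → Q a c = 0)
    (hfin : ∀ a, totalWt (fun a c => ENNReal.ofReal (Q a c)) a ≠ ⊤) (a : 𝒳) :
    (totalWt (fun a c => ENNReal.ofReal (Q a c)) a).toReal = ∑ c ∈ S, Q a c *
      (c.map fun b => (totalWt (fun a c => ENNReal.ofReal (Q a c)) b).toReal).prod := by
  have h1 := totalWt_eq (fun a c => ENNReal.ofReal (Q a c)) a
  have h2 : totalWt (fun a c => ENNReal.ofReal (Q a c)) = fun b =>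
      ENNReal.ofReal (totalWt (fun a c => ENNReal.ofReal (Q a c)) b).toReal :=
    funext fun b => (ENNReal.ofReal_toReal (hfin b)).symm
  have hprod : ∀ c : List 𝒳, 0 ≤ (c.map fun b =>
      (totalWt (fun a c => ENNReal.ofReal (Q a c)) b).toReal).prod := fun c =>
    List.prod_nonneg fun x hx => by
      obtain ⟨b, -, rfl⟩ := List.mem_map.1 hx
      exact ENNReal.toReal_nonneg
  conv_lhs => rw [h1, h2]
  rw [tsum_ofReal_mul hQ0 hS (fun b => ENNReal.toReal_nonneg), ENNReal.toReal_ofReal]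
  exact Finset.sum_nonneg fun c _ => mul_nonneg (hQ0 _ _) (hprod c)

theorem totalWt_le_one (a : 𝒳) : totalWt (fun a c => ENNReal.ofReal (Q a c)) a ≤ 1 := by
  refine totalWt_le_of_supersolution (u := fun _ => 1) (fun a => ?_) a
  have := tsum_ofReal_mul h.nonneg h.support (u := fun _ => 1) (fun _ => zero_le_one) a
  simp only [ENNReal.ofReal_one] at this
  rw [this]
  simp [h.sum_eq_one]

omit [Fintype 𝒳] [DecidableEq 𝒳] h in
theorem prod_one_sub_bounds {x : 𝒳 → ℝ} (h0 : ∀ a, 0 ≤ x a) (h1 : ∀ a, x a ≤ 1)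
    (c : List 𝒳) : 0 ≤ (c.map fun b => 1 - x b).prod ∧ (c.map fun b => 1 - x b).prod ≤ 1 ∧
      1 - (c.map x).sum ≤ (c.map fun b => 1 - x b).prod := by
  induction c with
  | nil => simp
  | cons d c ih =>
    obtain ⟨i1, i2, i3⟩ := ih
    simp only [List.map_cons, List.prod_cons, List.sum_cons]
    have := h0 d
    have := h1 d
    refine ⟨mul_nonneg (by linarith) i1, by nlinarith, by nlinarith⟩

omit [Fintype 𝒳] [DecidableEq 𝒳] h in
theorem one_add_sum_le_prod {x : 𝒳 → ℝ} (h0 : ∀ a, 0 ≤ x a) (c : List 𝒳) :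
    0 ≤ (c.map x).sum ∧ 1 + (c.map x).sum ≤ (c.map fun b => 1 + x b).prod := by
  induction c with
  | nil => simp
  | cons d c ih =>
    obtain ⟨i1, i2⟩ := ih
    simp only [List.map_cons, List.prod_cons, List.sum_cons]
    have := h0 d
    exact ⟨by linarith, by nlinarith⟩

/-- A critical Galton–Watson tree is almost surely finite. -/
theorem totalWt_eq_one (a : 𝒳) : totalWt (fun a c => ENNReal.ofReal (Q a c)) a = 1 := by
  have hfin : ∀ a, totalWt (fun a c => ENNReal.ofReal (Q a c)) a ≠ ⊤ := fun a =>
    ne_top_of_le_ne_top ENNReal.one_ne_top (h.totalWt_le_one a)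
  set x : 𝒳 → ℝ := fun a => 1 - (totalWt (fun a c => ENNReal.ofReal (Q a c)) a).toReal with hx
  have hx0 : ∀ a, 0 ≤ x a := fun a => by
    have := ENNReal.toReal_mono ENNReal.one_ne_top (h.totalWt_le_one a)
    simp only [ENNReal.toReal_one] at this
    simp only [hx]
    linarith
  have hx1 : ∀ a, x a ≤ 1 := fun a => by
    have : 0 ≤ (totalWt (fun a c => ENNReal.ofReal (Q a c)) a).toReal := ENNReal.toReal_nonneg
    simp only [hx]
    linarith
  have hrec : ∀ a, x a = ∑ c ∈ S, Q a c * (1 - (c.map fun b => 1 - x b).prod) := fun a => by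
    simp only [mul_sub, mul_one, Finset.sum_sub_distrib, h.sum_eq_one]
    simp only [hx, sub_sub_cancel]
    rw [← toReal_totalWt_eq h.nonneg h.support hfin]
  have hterm : ∀ a c, 0 ≤ Q a c * ((c.map x).sum - (1 - (c.map fun b => 1 - x b).prod)) :=
    fun a c => mul_nonneg (h.nonneg _ _) (by linarith [(prod_one_sub_bounds hx0 hx1 c).2.2])
  have hsum : ∑ a, p a * ∑ c ∈ S,
      Q a c * ((c.map x).sum - (1 - (c.map fun b => 1 - x b).prod)) = 0 := by
    have : ∀ a, p a * ∑ c ∈ S, Q a c * ((c.map x).sum - (1 - (c.map fun b => 1 - x b).prod))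
        = p a * ∑ c ∈ S, Q a c * (c.map x).sum - p a * x a := fun a => by
      conv_rhs => rw [hrec a]
      simp only [mul_sub (Q a _) (List.sum _), Finset.sum_sub_distrib]
      ring
    simp only [this, Finset.sum_sub_distrib, h.sum_p_mul_sum, sub_self]
  have hzero : ∀ a c, 0 < Q a c → (c.map x).sum = 1 - (c.map fun b => 1 - x b).prod := by
    intro a c hc
    have h1 := (Finset.sum_eq_zero_iff_of_nonneg fun a _ =>
      mul_nonneg (h.pos a).le (Finset.sum_nonneg fun c _ => hterm a c)).1 hsum a
      (Finset.mem_univ a)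
    have h2 := (mul_eq_zero.1 h1).resolve_left (h.pos a).ne'
    have h3 := (Finset.sum_eq_zero_iff_of_nonneg fun c _ => hterm a c).1 h2 c (h.mem_of_pos hc)
    have h4 := (mul_eq_zero.1 h3).resolve_left hc.ne'
    linarith
  suffices hall : ∃ a, x a = 0 by
    obtain ⟨a₀, ha₀⟩ := hall
    have : x a = 0 := by
      refine h.forall_of_step (P := fun a => x a = 0) ha₀ (fun a c d hc hd ha => ?_) a
      rw [hrec a, Finset.sum_eq_zero_iff_of_nonneg] at ha
      · have h1 := ha c (h.mem_of_pos hc)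
        rw [← hzero a c hc] at h1
        have h2 := (mul_eq_zero.1 h1).resolve_left hc.ne'
        refine le_antisymm ?_ (hx0 d)
        rw [← h2]
        exact List.single_le_sum (by simpa using fun b _ => hx0 b) _ (List.mem_map_of_mem hd)
      · exact fun c _ => mul_nonneg (h.nonneg _ _)
          (by linarith [(prod_one_sub_bounds hx0 hx1 c).2.1])
    simp only [hx, sub_eq_zero] at this
    rw [← ENNReal.ofReal_toReal (hfin a), ← this, ENNReal.ofReal_one]
  by_contra! hne
  have hpos : ∀ a, 0 < x a := fun a => (hx0 a).lt_of_ne' (hne a)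
  obtain ⟨a, d₁, d₂, c, hc⟩ := h.exists_branching
  have h1 := hzero a _ hc
  simp only [List.map_cons, List.sum_cons, List.prod_cons] at h1
  obtain ⟨i1, i2, i3⟩ := prod_one_sub_bounds hx0 hx1 c
  have h2 := hpos d₁
  have h3 := hpos d₂
  rcases i1.eq_or_lt with h0 | h0
  · rw [← h0] at h1 i3
    linarith
  · nlinarith [mul_pos (mul_pos h2 h3) h0]

theorem one_le_totalWt_mul {z : ℝ} (hz : 1 < z) (b : 𝒳) :
    1 ≤ totalWt (fun a c => ENNReal.ofReal (z * Q a c)) b := by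
  simp only [ENNReal.ofReal_mul (zero_le_one.trans hz.le)]
  rw [← h.totalWt_eq_one b, totalWt_const_mul]
  have := totalWt_const_mul (fun a c => ENNReal.ofReal (Q a c)) 1 b
  simp only [one_mul, one_pow] at this
  rw [this]
  refine ENNReal.tsum_le_tsum fun n => ?_
  refine le_mul_of_one_le_left zero_le (one_le_pow₀ ?_)
  exact ENNReal.one_le_ofReal.2 hz.le

/-- The generating function of the total progeny has radius of convergence at most one. -/
theorem totalWt_mul_eq_top {z : ℝ} (hz : 1 < z) (a₀ : 𝒳) :
    totalWt (fun a c => ENNReal.ofReal (z * Q a c)) a₀ = ⊤ := by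
  have hz0 : 0 < z := zero_lt_one.trans hz
  by_contra ha₀
  have hfin : ∀ a, totalWt (fun a c => ENNReal.ofReal (z * Q a c)) a ≠ ⊤ := by
    refine fun a => h.forall_of_step (P := fun a =>
      totalWt (fun a c => ENNReal.ofReal (z * Q a c)) a ≠ ⊤) ha₀ (fun a c d hc hd ha => ?_) a
    rw [totalWt_eq] at ha
    have h1 := ne_top_of_le_ne_top ha (ENNReal.le_tsum c)
    have h2 : totalWt (fun a c => ENNReal.ofReal (z * Q a c)) d
        ≤ (c.map (totalWt fun a c => ENNReal.ofReal (z * Q a c))).prod :=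
      List.single_le_prod (by simpa using fun b _ => h.one_le_totalWt_mul hz b) _
        (List.mem_map_of_mem hd)
    refine ne_top_of_le_ne_top ?_ h2
    intro htop
    rw [htop, ENNReal.mul_top (ENNReal.ofReal_pos.2 (mul_pos hz0 hc)).ne'] at h1
    exact h1 rfl
  set x : 𝒳 → ℝ := fun a =>
    (totalWt (fun a c => ENNReal.ofReal (z * Q a c)) a).toReal - 1 with hx
  have hx0 : ∀ a, 0 ≤ x a := fun a => by
    have := ENNReal.toReal_mono (hfin a) (h.one_le_totalWt_mul hz a)
    simp only [ENNReal.toReal_one] at this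
    simp only [hx]
    linarith
  have hrec : ∀ a, 1 + x a = z * ∑ c ∈ S, Q a c * (c.map fun b => 1 + x b).prod := fun a => by
    simp only [hx, add_sub_cancel]
    rw [toReal_totalWt_eq (S := S) (fun a c => mul_nonneg hz0.le (h.nonneg a c))
      (fun a c hc => by rw [h.support a c hc, mul_zero]) hfin, Finset.mul_sum]
    simp only [mul_assoc]
  have hle : ∀ a, z * (1 + ∑ c ∈ S, Q a c * (c.map x).sum) ≤ 1 + x a := fun a => by
    rw [hrec a]
    refine mul_le_mul_of_nonneg_left ?_ hz0.le
    have : 1 + ∑ c ∈ S, Q a c * (c.map x).sum = ∑ c ∈ S, Q a c * (1 + (c.map x).sum) := by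
      simp only [mul_add, mul_one, Finset.sum_add_distrib, h.sum_eq_one]
    rw [this]
    exact Finset.sum_le_sum fun c _ =>
      mul_le_mul_of_nonneg_left (one_add_sum_le_prod hx0 c).2 (h.nonneg a c)
  have h1 : ∑ a, p a * (z * (1 + ∑ c ∈ S, Q a c * (c.map x).sum)) ≤ ∑ a, p a * (1 + x a) :=
    Finset.sum_le_sum fun a _ => mul_le_mul_of_nonneg_left (hle a) (h.pos a).le
  have h2 : ∑ a, p a * (z * (1 + ∑ c ∈ S, Q a c * (c.map x).sum))
      = z * (1 + ∑ a, p a * x a) := by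
    rw [← h.sum_p_mul_sum x, ← h.sum_p, ← Finset.sum_add_distrib, Finset.mul_sum]
    refine Finset.sum_congr rfl fun a _ => ?_
    rw [h.sum_p]
    ring
  have h3 : ∑ a, p a * (1 + x a) = 1 + ∑ a, p a * x a := by
    simp only [mul_add, mul_one, Finset.sum_add_distrib, h.sum_p]
  have h4 : 0 ≤ ∑ a, p a * x a := Finset.sum_nonneg fun a _ => mul_nonneg (h.pos a).le (hx0 a)
  rw [h2, h3] at h1
  nlinarith

theorem exists_tilted_supersolution [Nonempty 𝒳] {g : 𝒳 → List 𝒳 → ℝ}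
    (hg : ∑ a, p a * ∑ c ∈ S, Q a c * g a c < 0) :
    ∃ l : ℝ, 0 < l ∧ ∃ u : 𝒳 → ℝ, (∀ a, 0 < u a) ∧
      ∀ a, ∑ c ∈ S, Q a c * Real.exp (l * g a c) * (c.map u).prod ≤ u a := by
  set m := ∑ a, p a * ∑ c ∈ S, Q a c * g a c with hm
  obtain ⟨v, hv⟩ := exists_transpose_solution (gwA_nonneg h.nonneg) h.irreducible h.pos
    h.critical (g := fun a => ∑ c ∈ S, Q a c * g a c - m)
    (by simp only [mul_sub, Finset.sum_sub_distrib, ← Finset.sum_mul, h.sum_p, ← hm]; ring)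
  simp only [sum_gwA_mul h.support] at hv
  let F : 𝒳 → ℝ → ℝ := fun a l =>
    ∑ c ∈ S, Q a c * Real.exp (l * (g a c + (c.map v).sum - v a))
  have hF : ∀ a, HasDerivAt (F a) m 0 := fun a => by
    have h1 : HasDerivAt (F a)
        (∑ c ∈ S, Q a c * (Real.exp (0 * (g a c + (c.map v).sum - v a))
          * (1 * (g a c + (c.map v).sum - v a)))) 0 :=
      HasDerivAt.fun_sum fun c _ =>
        (((hasDerivAt_id (0 : ℝ)).mul_const _).exp).const_mul _
    convert h1 using 1
    simp only [zero_mul, Real.exp_zero, one_mul]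
    simp only [mul_sub, mul_add, Finset.sum_sub_distrib, Finset.sum_add_distrib, ← Finset.sum_mul, h.sum_eq_one]
    linarith [hv a]
  have hF0 : ∀ a, F a 0 = 1 := fun a => by simp [F, h.sum_eq_one]
  have hev : ∀ a, ∀ᶠ l in nhdsWithin 0 (Set.Ioi (0 : ℝ)), F a l ≤ 1 := fun a => by
    have h1 := (hasDerivAt_iff_tendsto_slope.1 (hF a)).mono_left
      (nhdsWithin_mono 0 fun l (hl : 0 < l) => hl.ne')
    filter_upwards [h1.eventually_lt_const hg, self_mem_nhdsWithin] with l hl hl0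
    rw [slope_def_field, hF0, sub_zero, div_lt_iff₀ hl0, zero_mul] at hl
    linarith
  obtain ⟨l, hl, hl0⟩ := ((Filter.eventually_all.2 hev).and self_mem_nhdsWithin).exists
  refine ⟨l, hl0, fun a => Real.exp (l * v a), fun a => Real.exp_pos _, fun a => ?_⟩
  have hprod : ∀ c : List 𝒳, (c.map fun b => Real.exp (l * v b)).prod
      = Real.exp (l * (c.map v).sum) := fun c => by
    induction c with
    | nil => simp
    | cons d c ih => simp [ih, mul_add, Real.exp_add]
  calc ∑ c ∈ S, Q a c * Real.exp (l * g a c) * (c.map fun b => Real.exp (l * v b)).prod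
      = Real.exp (l * v a) * F a l := by
        rw [Finset.mul_sum]
        refine Finset.sum_congr rfl fun c _ => ?_
        rw [hprod, mul_assoc, ← Real.exp_add, mul_left_comm, ← Real.exp_add]
        congr 2
        ring
    _ ≤ Real.exp (l * v a) := mul_le_of_le_one_right (Real.exp_pos _).le (hl a)

omit [Fintype 𝒳] [DecidableEq 𝒳] h in
theorem ewt_tilt (hQ0 : ∀ a c, 0 ≤ Q a c) (g : 𝒳 → List 𝒳 → ℝ) (l r : ℝ) (t : GWTree 𝒳) :
    ewt (fun a c => ENNReal.ofReal (Q a c * Real.exp (l * (g a c + r)))) t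
      = ENNReal.ofReal (Real.exp (l * ((t.data.map fun x => g x.1 x.2).sum + r * t.size)))
        * ewt (fun a c => ENNReal.ofReal (Q a c)) t := by
  rw [ewt, ewt, ← data_length]
  induction t.data with
  | nil => simp
  | cons x d ih =>
    simp only [List.map_cons, List.prod_cons, List.sum_cons, List.length_cons]
    rw [ih, ENNReal.ofReal_mul (hQ0 _ _)]
    have : l * (g x.1 x.2 + (d.map fun x => g x.1 x.2).sum + r * ((d.length + 1 : ℕ) : ℝ))
        = l * (g x.1 x.2 + r) + l * ((d.map fun x => g x.1 x.2).sum + r * d.length) := by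
      push_cast
      ring
    rw [this, Real.exp_add, ENNReal.ofReal_mul (Real.exp_pos _).le]
    ring

open Classical in
/-- Exponential upper bound for the weight of large trees along which an additive functional of
negative mean is nonnegative. -/
theorem exists_exponential_bound [Nonempty 𝒳] {g : 𝒳 → List 𝒳 → ℝ}
    (hg : ∑ a, p a * ∑ c ∈ S, Q a c * g a c < 0) :
    ∃ r : ℝ, 0 < r ∧ ∃ C : ℝ, 0 < C ∧ ∀ a n, (∑' t : GWTree 𝒳,
      if root t = a ∧ size t = n ∧ 0 ≤ (t.data.map fun x => g x.1 x.2).sum then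
        ewt (fun a c => ENNReal.ofReal (Q a c)) t else 0)
      ≤ ENNReal.ofReal (C * Real.exp (-r * n)) := by
  set m := ∑ a, p a * ∑ c ∈ S, Q a c * g a c with hm
  have hg' : ∑ a, p a * ∑ c ∈ S, Q a c * (g a c + -m / 2) < 0 := by
    have : ∑ a, p a * ∑ c ∈ S, Q a c * (g a c + -m / 2) = m + -m / 2 := by
      simp only [mul_add, Finset.sum_add_distrib, ← Finset.sum_mul, h.sum_eq_one, one_mul,
        h.sum_p, hm]
    rw [this]
    linarith
  obtain ⟨l, hl, u, hu, hsup⟩ := h.exists_tilted_supersolution hg'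
  have hQ' : ∀ a c, 0 ≤ Q a c * Real.exp (l * (g a c + -m / 2)) := fun a c =>
    mul_nonneg (h.nonneg _ _) (Real.exp_pos _).le
  have htot : ∀ a, totalWt (fun a c =>
      ENNReal.ofReal (Q a c * Real.exp (l * (g a c + -m / 2)))) a ≤ ENNReal.ofReal (u a) :=
    totalWt_le_of_supersolution fun a => by
      rw [tsum_ofReal_mul (S := S) hQ' (fun a c hc => by rw [h.support a c hc, zero_mul])
        fun b => (hu b).le]
      exact ENNReal.ofReal_le_ofReal (hsup a)
  refine ⟨l * (-m / 2), mul_pos hl (by linarith), ∑ a, u a,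
    Finset.sum_pos (fun a _ => hu a) Finset.univ_nonempty, fun a n => ?_⟩
  have key : (∑' t : GWTree 𝒳,
      if root t = a ∧ size t = n ∧ 0 ≤ (t.data.map fun x => g x.1 x.2).sum then
        ewt (fun a c => ENNReal.ofReal (Q a c)) t else 0)
      ≤ ENNReal.ofReal (Real.exp (-(l * (-m / 2)) * n)) * totalWt (fun a c =>
      ENNReal.ofReal (Q a c * Real.exp (l * (g a c + -m / 2)))) a := by
    rw [totalWt, ← ENNReal.tsum_mul_left]
    refine ENNReal.tsum_le_tsum fun t => ?_
    split_ifs with h1 h2 h2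
    · rw [ewt_tilt h.nonneg, ← mul_assoc, ← ENNReal.ofReal_mul (Real.exp_pos _).le,
        ← Real.exp_add]
      refine le_mul_of_one_le_left zero_le ?_
      rw [ENNReal.one_le_ofReal, Real.one_le_exp_iff, h1.2.1]
      nlinarith [mul_nonneg hl.le h1.2.2]
    · exact absurd h1.1 h2
    · exact zero_le
    · exact zero_le
  refine key.trans ?_
  rw [mul_comm (∑ a, u a), ENNReal.ofReal_mul (Real.exp_pos _).le]
  gcongr
  exact (htot a).trans (ENNReal.ofReal_le_ofReal
    (Finset.single_le_sum (fun a _ => (hu a).le) (Finset.mem_univ a)))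

/-- From a tree rooted at `b` one can reach, at bounded cost, a vertex of any type `d`. -/
theorem exists_chain (b d : 𝒳) : ∃ (s : ℕ) (κ : ℝ≥0∞), κ ≠ 0 ∧ ∀ n,
    κ * sizeWt (fun a c => ENNReal.ofReal (Q a c)) d n
      ≤ sizeWt (fun a c => ENNReal.ofReal (Q a c)) b (n + s) := by
  have hex : ∀ e, ∃ n, sizeWt (fun a c => ENNReal.ofReal (Q a c)) e n ≠ 0 := fun e =>
    exists_sizeWt_pos (by rw [h.totalWt_eq_one]; exact one_ne_zero)
  choose N hN using hex
  refine h.forall_of_step (a := b) (P := fun d => ∃ (s : ℕ) (κ : ℝ≥0∞), κ ≠ 0 ∧ ∀ n,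
    κ * sizeWt (fun a c => ENNReal.ofReal (Q a c)) d n
      ≤ sizeWt (fun a c => ENNReal.ofReal (Q a c)) b (n + s))
    ⟨0, 1, one_ne_zero, fun n => by simp⟩ ?_ d
  rintro a c d hc hd ⟨s, κ, hκ, hle⟩
  obtain ⟨c₁, c₂, rfl⟩ := List.append_of_mem hd
  refine ⟨1 + (c₁.map N).sum + (c₂.map N).sum + s, κ * (ENNReal.ofReal (Q a (c₁ ++ d :: c₂)) *
    ((c₁.map fun e => sizeWt (fun a c => ENNReal.ofReal (Q a c)) e (N e)).prod *
      (c₂.map fun e => sizeWt (fun a c => ENNReal.ofReal (Q a c)) e (N e)).prod)), ?_,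
    fun n => ?_⟩
  · simp [hκ, hc, List.prod_eq_zero_iff, hN]
  · have h1 := le_sizeWt (fun a c => ENNReal.ofReal (Q a c)) a
      (c₁.map (fun e => (e, N e)) ++ (d, n) :: c₂.map (fun e => (e, N e)))
    have h2 := hle (1 + (c₁.map N).sum + (c₂.map N).sum + n)
    simp only [List.map_append, List.map_cons, List.map_map, List.prod_append, List.prod_cons,
      List.sum_append, List.sum_cons, Function.comp_def, List.map_id'] at h1
    calc _ = κ * (ENNReal.ofReal (Q a (c₁ ++ d :: c₂)) *
        ((c₁.map fun e => sizeWt (fun a c => ENNReal.ofReal (Q a c)) e (N e)).prod *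
        (sizeWt (fun a c => ENNReal.ofReal (Q a c)) d n *
        (c₂.map fun e => sizeWt (fun a c => ENNReal.ofReal (Q a c)) e (N e)).prod))) := by ring
      _ ≤ _ := mul_le_mul_right h1 κ
      _ ≤ _ := by
        convert hle _ using 2
        ring

theorem exists_supermul (b : 𝒳) : ∃ (s : ℕ) (κ : ℝ≥0∞), κ ≠ 0 ∧ κ ≠ ⊤ ∧ 0 < s ∧ ∀ m n,
    κ * (sizeWt (fun a c => ENNReal.ofReal (Q a c)) b m *
      sizeWt (fun a c => ENNReal.ofReal (Q a c)) b n)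
      ≤ sizeWt (fun a c => ENNReal.ofReal (Q a c)) b (m + n + s) := by
  have hex : ∀ e, ∃ n, sizeWt (fun a c => ENNReal.ofReal (Q a c)) e n ≠ 0 := fun e =>
    exists_sizeWt_pos (by rw [h.totalWt_eq_one]; exact one_ne_zero)
  choose N hN using hex
  obtain ⟨a, d₁, d₂, c, hc⟩ := h.exists_branching
  obtain ⟨s, κ, hκ, hle⟩ := h.exists_chain b a
  obtain ⟨s₁, κ₁, hκ₁, hle₁⟩ := h.exists_chain d₁ b
  obtain ⟨s₂, κ₂, hκ₂, hle₂⟩ := h.exists_chain d₂ b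
  set y := sizeWt (fun a c => ENNReal.ofReal (Q a c)) with hy
  set P := (c.map fun e => y e (N e)).prod with hP
  set θ := κ * (ENNReal.ofReal (Q a (d₁ :: d₂ :: c)) * (κ₁ * (κ₂ * P))) with hθ
  have hP0 : P ≠ 0 := by simp [P, List.prod_eq_zero_iff, hN]
  have hθ0 : θ ≠ 0 := by simp [θ, hκ, hκ₁, hκ₂, hP0, hc]
  refine ⟨1 + s₁ + s₂ + (c.map N).sum + s, min θ 1, ?_, ?_, by omega, fun m n => ?_⟩
  · exact (lt_min (pos_iff_ne_zero.2 hθ0) one_pos).ne'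
  · exact ne_top_of_le_ne_top ENNReal.one_ne_top (min_le_right _ _)
  · have h1 := le_sizeWt (fun a c => ENNReal.ofReal (Q a c)) a
      ((d₁, m + s₁) :: (d₂, n + s₂) :: c.map (fun e => (e, N e)))
    simp only [List.map_cons, List.map_map, List.prod_cons,
      List.sum_cons, Function.comp_def, List.map_id', ← hy, ← hP] at h1
    calc _ ≤ θ * (y b m * y b n) := mul_le_mul_left (min_le_left _ _) _
      _ = κ * (ENNReal.ofReal (Q a (d₁ :: d₂ :: c)) *
          ((κ₁ * y b m) * ((κ₂ * y b n) * P))) := by rw [hθ]; ring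
      _ ≤ κ * (ENNReal.ofReal (Q a (d₁ :: d₂ :: c)) *
          (y d₁ (m + s₁) * (y d₂ (n + s₂) * P))) := by
          gcongr
          · exact hle₁ m
          · exact hle₂ n
      _ ≤ _ := mul_le_mul_right h1 κ
      _ ≤ _ := by
        convert hle _ using 2
        ring

/-- Trees rooted at `b` can be enlarged along an arithmetic progression at subexponential cost. -/
theorem exists_period (b : 𝒳) {ε : ℝ} (hε : 0 < ε) : ∃ P : ℕ, 0 < P ∧ ∀ r j : ℕ,
    ENNReal.ofReal (Real.exp (-ε * P)) ^ j * sizeWt (fun a c => ENNReal.ofReal (Q a c)) b r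
      ≤ sizeWt (fun a c => ENNReal.ofReal (Q a c)) b (r + j * P) := by
  obtain ⟨s, κ, hκ, hκ', hs, hle⟩ := h.exists_supermul b
  set y := sizeWt (fun a c => ENNReal.ofReal (Q a c)) with hy
  have hm : ∃ m : ℕ, ENNReal.ofReal (Real.exp (-ε * (m + s : ℕ))) ≤ κ * y b m := by
    by_contra! hlt
    have h1 := h.totalWt_mul_eq_top (Real.one_lt_exp_iff.2 (half_pos hε)) b
    simp only [ENNReal.ofReal_mul (Real.exp_pos _).le] at h1
    rw [totalWt_const_mul] at h1
    have h2 : κ * ∑' n, ENNReal.ofReal (Real.exp (ε / 2)) ^ n * y b n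
        ≤ ∑' n, ENNReal.ofReal (Real.exp (-(ε / 2))) ^ n := by
      rw [← ENNReal.tsum_mul_left]
      refine ENNReal.tsum_le_tsum fun n => ?_
      rw [mul_left_comm]
      refine (mul_le_mul_right (hlt n).le _).trans ?_
      rw [← ENNReal.ofReal_pow (Real.exp_pos _).le, ← ENNReal.ofReal_pow (Real.exp_pos _).le,
        ← ENNReal.ofReal_mul (by positivity), ← Real.exp_nat_mul, ← Real.exp_nat_mul,
        ← Real.exp_add]
      refine ENNReal.ofReal_le_ofReal (Real.exp_le_exp.2 ?_)
      push_cast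
      nlinarith [mul_nonneg hε.le (Nat.cast_nonneg (α := ℝ) s)]
    rw [h1, ENNReal.mul_top hκ, ENNReal.tsum_geometric, top_le_iff, ENNReal.inv_eq_top,
      tsub_eq_zero_iff_le, ENNReal.one_le_ofReal, Real.one_le_exp_iff] at h2
    linarith
  obtain ⟨m, hm⟩ := hm
  refine ⟨m + s, by omega, fun r j => ?_⟩
  induction j with
  | zero => simp
  | succ j ih =>
    calc _ = ENNReal.ofReal (Real.exp (-ε * (m + s : ℕ))) *
          (ENNReal.ofReal (Real.exp (-ε * (m + s : ℕ))) ^ j * y b r) := by ring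
      _ ≤ (κ * y b m) * y b (r + j * (m + s)) := mul_le_mul' hm ih
      _ = κ * (y b m * y b (r + j * (m + s))) := mul_assoc _ _ _
      _ ≤ y b (m + (r + j * (m + s)) + s) := hle _ _
      _ = _ := by
        congr 1
        ring

omit h in
theorem tsum_wt_eq_toReal {μ : 𝒳 → ℝ} (hμ0 : ∀ a, 0 ≤ μ a)
    (hQ0 : ∀ a c, 0 ≤ Q a c)
    (A : GWTree 𝒳 → Prop) [DecidablePred A] :
    (∑' t : GWTree 𝒳, if A t then μ t.root * wt Q t else 0)
      = (∑ a, ENNReal.ofReal (μ a) * ∑' t : GWTree 𝒳, if root t = a ∧ A t then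
        ewt (fun a c => ENNReal.ofReal (Q a c)) t else 0).toReal := by
  have hwt : ∀ t : GWTree 𝒳, 0 ≤ wt Q t := fun t => by
    rw [wt_eq_prod]
    refine List.prod_nonneg fun x hx => ?_
    obtain ⟨b, -, rfl⟩ := List.mem_map.1 hx
    exact hQ0 _ _
  have h1 : (∑ a, ENNReal.ofReal (μ a) * ∑' t : GWTree 𝒳, if root t = a ∧ A t then
      ewt (fun a c => ENNReal.ofReal (Q a c)) t else 0)
      = ∑' t : GWTree 𝒳, ENNReal.ofReal (if A t then μ t.root * wt Q t else 0) := by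
    simp only [← ENNReal.tsum_mul_left]
    rw [← Summable.tsum_finsetSum fun _ _ => ENNReal.summable]
    refine tsum_congr fun t => ?_
    rw [Finset.sum_eq_single t.root]
    · by_cases hA : A t <;> simp [hA, ewt_ofReal Q hQ0, ENNReal.ofReal_mul (hμ0 _)]
    · intro b _ hb
      simp [hb.symm]
    · simp
  rw [h1, ENNReal.tsum_toReal_eq fun _ => ENNReal.ofReal_ne_top]
  refine tsum_congr fun t => (ENNReal.toReal_ofReal ?_).symm
  split_ifs
  · exact mul_nonneg (hμ0 _) (hwt t)
  · exact le_rfl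

omit h in
theorem Zn_eq_toReal {μ : 𝒳 → ℝ} (hμ0 : ∀ a, 0 ≤ μ a)
    (hQ0 : ∀ a c, 0 ≤ Q a c) (n : ℕ) :
    Zn μ Q n = (∑ a, ENNReal.ofReal (μ a) *
      sizeWt (fun a c => ENNReal.ofReal (Q a c)) a n).toReal := by
  rw [Zn, tsum_wt_eq_toReal hμ0 hQ0]
  refine congrArg _ (Finset.sum_congr rfl fun a _ => ?_)
  rw [sizeWt]
  congr 2
  funext t
  congr

theorem sum_sizeWt_le_one {μ : 𝒳 → ℝ} (hμ0 : ∀ a, 0 ≤ μ a) (hμ1 : ∑ a, μ a = 1) (n : ℕ) :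
    ∑ a, ENNReal.ofReal (μ a) * sizeWt (fun a c => ENNReal.ofReal (Q a c)) a n ≤ 1 := by
  calc _ ≤ ∑ a, ENNReal.ofReal (μ a) := Finset.sum_le_sum fun a _ =>
        mul_le_of_le_one_right zero_le ((sizeWt_le_totalWt _ a n).trans (h.totalWt_le_one a))
    _ = 1 := by rw [← ENNReal.ofReal_sum_of_nonneg fun a _ => hμ0 a, hμ1, ENNReal.ofReal_one]

theorem Zn_le_one {μ : 𝒳 → ℝ} (hμ0 : ∀ a, 0 ≤ μ a) (hμ1 : ∑ a, μ a = 1) (n : ℕ) :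
    Zn μ Q n ≤ 1 := by
  rw [Zn_eq_toReal hμ0 h.nonneg]
  simpa using ENNReal.toReal_mono ENNReal.one_ne_top (h.sum_sizeWt_le_one hμ0 hμ1 n)

/-- The probability of having exactly `n` vertices decays subexponentially. -/
theorem exists_Zn_lower_bound {μ : 𝒳 → ℝ} (hμ0 : ∀ a, 0 ≤ μ a) (hμ1 : ∑ a, μ a = 1)
    (hZ : ∀ n : ℕ, 1 ≤ n → 0 < Zn μ Q n) {ε : ℝ} (hε : 0 < ε) :
    ∃ c : ℝ, 0 < c ∧ ∀ n : ℕ, 1 ≤ n → c * Real.exp (-ε * n) ≤ Zn μ Q n := by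
  choose P hP hle using fun b => h.exists_period b hε
  set R := ∏ a, P a with hR
  have hR0 : 0 < R := Finset.prod_pos fun a _ => hP a
  have hstep : ∀ r j : ℕ, Real.exp (-ε * R) ^ j * Zn μ Q r ≤ Zn μ Q (r + j * R) := by
    intro r j
    rw [Zn_eq_toReal hμ0 h.nonneg, Zn_eq_toReal hμ0 h.nonneg,
      ← ENNReal.toReal_ofReal (pow_nonneg (Real.exp_pos (-ε * R)).le j), ← ENNReal.toReal_mul]
    refine ENNReal.toReal_mono
      (ne_top_of_le_ne_top ENNReal.one_ne_top (h.sum_sizeWt_le_one hμ0 hμ1 _)) ?_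
    rw [Finset.mul_sum]
    refine Finset.sum_le_sum fun a _ => ?_
    rw [mul_left_comm]
    refine mul_le_mul_right ?_ _
    obtain ⟨k, hk⟩ : P a ∣ R := Finset.dvd_prod_of_mem P (Finset.mem_univ a)
    have h1 := hle a r (k * j)
    have h2 : r + k * j * P a = r + j * R := by rw [hk]; ring
    have h3 : Real.exp (-ε * P a) ^ (k * j) = Real.exp (-ε * R) ^ j := by
      rw [pow_mul, ← Real.exp_nat_mul, hk]
      congr 2
      push_cast
      ring
    rwa [h2, ← ENNReal.ofReal_pow (Real.exp_pos _).le, h3] at h1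
  obtain ⟨r₀, hr₀, hmin⟩ := Finset.exists_min_image (Finset.Icc 1 R) (Zn μ Q)
    ⟨1, Finset.mem_Icc.2 ⟨le_rfl, hR0⟩⟩
  refine ⟨Zn μ Q r₀, hZ r₀ (Finset.mem_Icc.1 hr₀).1, fun n hn => ?_⟩
  have hmod := Nat.mod_lt (n - 1) hR0
  have hdiv := Nat.mod_add_div' (n - 1) R
  have hn' : n = ((n - 1) % R + 1) + (n - 1) / R * R := by omega
  have h1 := hstep ((n - 1) % R + 1) ((n - 1) / R)
  rw [← hn', ← Real.exp_nat_mul] at h1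
  refine le_trans ?_ h1
  rw [mul_comm]
  refine mul_le_mul (Real.exp_le_exp.2 ?_)
    (hmin _ (Finset.mem_Icc.2 ⟨by omega, by omega⟩)) (hZ r₀ (Finset.mem_Icc.1 hr₀).1).le
    (Real.exp_pos _).le
  have h2 : (((n - 1) / R : ℕ) : ℝ) * R ≤ n := by
    have : (n - 1) / R * R ≤ n := by omega
    exact_mod_cast this
  nlinarith

omit [Fintype 𝒳] [DecidableEq 𝒳] h in
theorem log_wt {t : GWTree 𝒳} (ht : wt Q t ≠ 0) :
    Real.log (wt Q t) = (t.data.map fun x => Real.log (Q x.1 x.2)).sum := by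
  rw [wt_eq_prod] at ht ⊢
  rw [Real.log_list_prod, List.map_map]
  · rfl
  · exact fun x hx h0 => ht (List.prod_eq_zero (h0 ▸ hx))

omit [Fintype 𝒳] [DecidableEq 𝒳] h in
theorem sum_data_affine (f : 𝒳 × List 𝒳 → ℝ) (α β : ℝ) (t : GWTree 𝒳) :
    (t.data.map fun x => α * f x + β).sum = α * (t.data.map f).sum + β * t.size := by
  rw [← data_length]
  induction t.data with
  | nil => simp
  | cons x d ih =>
    simp only [List.map_cons, List.sum_cons, List.length_cons, ih]
    push_cast
    ring

open Classical in
/-- The conditional probability of an atypical empirical log-likelihood is exponentially small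
against a subexponential normalization. -/
theorem tendsto_condPr [Nonempty 𝒳] {μ : 𝒳 → ℝ} (hμ0 : ∀ a, 0 ≤ μ a) (hμ1 : ∑ a, μ a = 1)
    (hZ : ∀ n : ℕ, 1 ≤ n → 0 < Zn μ Q n) {H : ℝ}
    (hH : H = ∑ a, p a * ∑ c ∈ S, Q a c * Real.log (Q a c)) {ε : ℝ} (hε : 0 < ε) :
    Filter.Tendsto (fun n : ℕ => condPr μ Q n
      {t : GWTree 𝒳 | ε ≤ |(-(1/(n:ℝ)) * Real.log (μ t.root * GWTree.wt Q t / Zn μ Q n)) + H|})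
      Filter.atTop (nhds 0) := by
  have hmean : ∀ α β : ℝ, ∑ a, p a * ∑ c ∈ S, Q a c * (α * Real.log (Q a c) + β)
      = α * H + β := fun α β => by
    simp only [mul_add, Finset.sum_add_distrib, ← Finset.sum_mul, h.sum_eq_one, one_mul,
      h.sum_p, mul_left_comm _ α, ← Finset.mul_sum, hH]
  obtain ⟨r₁, hr₁, C₁, hC₁, hb₁⟩ := h.exists_exponential_bound
    (g := fun a c => 1 * Real.log (Q a c) + (-H - ε / 2)) (by rw [hmean]; linarith)
  obtain ⟨r₂, hr₂, C₂, hC₂, hb₂⟩ := h.exists_exponential_bound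
    (g := fun a c => (-1) * Real.log (Q a c) + (H - ε / 2)) (by rw [hmean]; linarith)
  set r := min r₁ r₂ with hr
  have hr0 : 0 < r := lt_min hr₁ hr₂
  obtain ⟨c, hc, hlow⟩ := h.exists_Zn_lower_bound hμ0 hμ1 hZ
    (ε := min (r / 2) (ε / 8)) (lt_min (by linarith) (by linarith))
  set B := ∑ a, |Real.log (μ a)| with hB
  have hlarge : ∀ᶠ n : ℕ in Filter.atTop, 1 ≤ n ∧ B + |Real.log c| ≤ n * (ε / 4) := by
    refine (Filter.eventually_ge_atTop 1).and ?_
    filter_upwards [(tendsto_natCast_atTop_atTop (R := ℝ)).eventually_ge_atTop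
      ((B + |Real.log c|) / (ε / 4))] with n hn
    rwa [div_le_iff₀ (by linarith)] at hn
  have hcond_nonneg : ∀ n (E : Set (GWTree 𝒳)), 0 ≤ condPr μ Q n E := fun n E => by
    rw [condPr, tsum_wt_eq_toReal hμ0 h.nonneg, Zn_eq_toReal hμ0 h.nonneg]
    exact div_nonneg ENNReal.toReal_nonneg ENNReal.toReal_nonneg
  have hlim : Filter.Tendsto (fun n : ℕ => (C₁ + C₂) / c * Real.exp (-(r / 2)) ^ n)
      Filter.atTop (nhds 0) := by
    simpa using (tendsto_pow_atTop_nhds_zero_of_lt_one (Real.exp_pos (-(r / 2))).le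
      (Real.exp_lt_one_iff.2 (by linarith))).const_mul ((C₁ + C₂) / c)
  refine tendsto_of_tendsto_of_tendsto_of_le_of_le' tendsto_const_nhds hlim
    (Filter.Eventually.of_forall fun n => hcond_nonneg n _) ?_
  filter_upwards [hlarge] with n ⟨hn1, hnB⟩
  set E := {t : GWTree 𝒳 | ε ≤ |(-(1/(n:ℝ)) * Real.log (μ t.root * GWTree.wt Q t / Zn μ Q n)) + H|}
    with hE
  have hn0 : (0 : ℝ) < n := by exact_mod_cast hn1
  have hZn := hZ n hn1
  have hlogZ0 : Real.log (Zn μ Q n) ≤ 0 := Real.log_nonpos hZn.le (h.Zn_le_one hμ0 hμ1 n)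
  have hlogZ1 : -|Real.log c| - ε / 8 * n ≤ Real.log (Zn μ Q n) := by
    have h1 := Real.log_le_log (mul_pos hc (Real.exp_pos _)) (hlow n hn1)
    rw [Real.log_mul hc.ne' (Real.exp_pos _).ne', Real.log_exp] at h1
    have h2 := mul_le_mul_of_nonneg_right (min_le_right (r / 2) (ε / 8)) hn0.le
    have h3 := neg_abs_le (Real.log c)
    linarith
  have hcases : ∀ t : GWTree 𝒳, t.size = n → t ∈ E → μ t.root ≠ 0 → wt Q t ≠ 0 →
      0 ≤ (t.data.map fun x => 1 * Real.log (Q x.1 x.2) + (-H - ε / 2)).sum ∨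
      0 ≤ (t.data.map fun x => (-1) * Real.log (Q x.1 x.2) + (H - ε / 2)).sum := by
    intro t ht htE hμt hwt
    rw [sum_data_affine (fun x => Real.log (Q x.1 x.2)),
      sum_data_affine (fun x => Real.log (Q x.1 x.2)), ← log_wt hwt, ht]
    rw [hE, Set.mem_ofPred_eq, Real.log_div (mul_ne_zero hμt hwt) hZn.ne',
      Real.log_mul hμt hwt] at htE
    have hμB : |Real.log (μ t.root)| ≤ B :=
      Finset.single_le_sum (f := fun a => |Real.log (μ a)|) (fun a _ => abs_nonneg _)
        (Finset.mem_univ t.root)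
    have h1 := (abs_le.1 hμB).1
    have h2 := (abs_le.1 hμB).2
    have h3 : -(1 / (n : ℝ)) * (Real.log (μ t.root) + Real.log (wt Q t) - Real.log (Zn μ Q n)) + H
        = -(Real.log (μ t.root) + Real.log (wt Q t) - Real.log (Zn μ Q n) - n * H) / n := by
      field_simp
      ring
    rw [h3, abs_div, abs_neg, Nat.abs_cast, le_div_iff₀ hn0] at htE
    have hεn : 0 < ε * n := mul_pos hε hn0
    have h4 := abs_nonneg (Real.log c)
    rcases le_abs'.1 htE with h5 | h5
    · right
      nlinarith
    · left
      nlinarith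
  have hexp : ∀ r', r ≤ r' → Real.exp (-r' * n) ≤ Real.exp (-r * n) := fun r' hr' =>
    Real.exp_le_exp.2 (by nlinarith)
  have hnum : ∑ a, ENNReal.ofReal (μ a) * (∑' t : GWTree 𝒳,
      if root t = a ∧ (t.size = n ∧ t ∈ E) then
        ewt (fun a c => ENNReal.ofReal (Q a c)) t else 0)
      ≤ ENNReal.ofReal ((C₁ + C₂) * Real.exp (-r * n)) := by
    have hterm : ∀ a, ENNReal.ofReal (μ a) * (∑' t : GWTree 𝒳,
        if root t = a ∧ (t.size = n ∧ t ∈ E) then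
          ewt (fun a c => ENNReal.ofReal (Q a c)) t else 0)
        ≤ ENNReal.ofReal (μ a) * ENNReal.ofReal ((C₁ + C₂) * Real.exp (-r * n)) := by
      intro a
      rcases (hμ0 a).eq_or_lt with h0 | h0
      · simp [← h0]
      refine mul_le_mul_right ?_ _
      calc _ ≤ ∑' t : GWTree 𝒳,
          ((if root t = a ∧ size t = n ∧ 0 ≤ (t.data.map fun x =>
              1 * Real.log (Q x.1 x.2) + (-H - ε / 2)).sum then
            ewt (fun a c => ENNReal.ofReal (Q a c)) t else 0) +
          (if root t = a ∧ size t = n ∧ 0 ≤ (t.data.map fun x =>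
              (-1) * Real.log (Q x.1 x.2) + (H - ε / 2)).sum then
            ewt (fun a c => ENNReal.ofReal (Q a c)) t else 0)) := by
            refine ENNReal.tsum_le_tsum fun t => ?_
            by_cases hA : root t = a ∧ (t.size = n ∧ t ∈ E)
            · rw [if_pos hA]
              by_cases hwt : wt Q t = 0
              · simp [ewt_ofReal Q h.nonneg, hwt]
              obtain ⟨hA1, hA2, hA3⟩ := hA
              rcases hcases t hA2 hA3 (hA1 ▸ h0.ne') hwt with h1 | h1
              · rw [if_pos ⟨hA1, hA2, h1⟩]
                exact le_self_add
              · rw [if_pos (c := root t = a ∧ size t = n ∧ 0 ≤ (t.data.map fun x =>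
                  (-1) * Real.log (Q x.1 x.2) + (H - ε / 2)).sum) ⟨hA1, hA2, h1⟩]
                exact le_add_self
            · rw [if_neg hA]
              exact zero_le
        _ ≤ ENNReal.ofReal (C₁ * Real.exp (-r₁ * n)) + ENNReal.ofReal (C₂ * Real.exp (-r₂ * n)) := by
            rw [ENNReal.tsum_add]
            exact add_le_add (hb₁ a n) (hb₂ a n)
        _ ≤ _ := by
            rw [← ENNReal.ofReal_add (by positivity) (by positivity), add_mul]
            refine ENNReal.ofReal_le_ofReal (add_le_add ?_ ?_)
            · exact mul_le_mul_of_nonneg_left (hexp _ (min_le_left _ _)) hC₁.le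
            · exact mul_le_mul_of_nonneg_left (hexp _ (min_le_right _ _)) hC₂.le
    refine (Finset.sum_le_sum fun a _ => hterm a).trans_eq ?_
    rw [← Finset.sum_mul, ← ENNReal.ofReal_sum_of_nonneg fun a _ => hμ0 a, hμ1,
      ENNReal.ofReal_one, one_mul]
  have hnum' : (∑' t : GWTree 𝒳, if t.size = n ∧ t ∈ E then μ t.root * wt Q t else 0)
      ≤ (C₁ + C₂) * Real.exp (-r * n) := by
    rw [tsum_wt_eq_toReal hμ0 h.nonneg]
    refine ENNReal.toReal_le_of_le_ofReal (by positivity) (le_of_eq_of_le ?_ hnum)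
    refine Finset.sum_congr rfl fun a _ => ?_
    congr 2
  rw [condPr]
  calc _ ≤ (C₁ + C₂) * Real.exp (-r * n) / (c * Real.exp (-(r / 2) * n)) := by
        refine div_le_div₀ (by positivity) ?_ (by positivity) (le_trans ?_ (hlow n hn1))
        · convert hnum'
        · refine mul_le_mul_of_nonneg_left (Real.exp_le_exp.2 ?_) hc.le
          have := mul_le_mul_of_nonneg_right (min_le_left (r / 2) (ε / 8)) hn0.le
          linarith
    _ = (C₁ + C₂) / c * Real.exp (-(r / 2)) ^ n := by
        rw [mul_div_mul_comm, ← Real.exp_sub, ← Real.exp_nat_mul]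
        congr 2
        ring

end IsCriticalKernel

end Kernel

/-- **AEP for simple hierarchical structures** (Theorem 2.1).
If `X` is an irreducible critical multitype Galton–Watson tree with finite type space `𝒳`
and bounded offspring kernel `Q`, conditioned to have `n` vertices, then for every `ε > 0`,
`ℙ_n{ |−(1/n) log P_n(X) + Σ_{(a,c)} π(a) Q(c|a) log Q(c|a)| ≥ ε } → 0`.

Irreducibility and criticality are encoded via: `A^k(a,b) > 0` for some `k ≥ 1` for all `a,b`,
and `π` being a probability vector satisfying `A π = π` (the Perron–Frobenius eigenvector
normalized to a probability vector, with largest eigenvalue `1`). -/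
theorem aep_multitype_galton_watson
    {𝒳 : Type} [Fintype 𝒳] [DecidableEq 𝒳] [Nonempty 𝒳]
    (μ : 𝒳 → ℝ) (hμ0 : ∀ a, 0 ≤ μ a) (hμ1 : ∑ a, μ a = 1)
    (Q : 𝒳 → List 𝒳 → ℝ) (hQ0 : ∀ a c, 0 ≤ Q a c) (hQ1 : ∀ a, ∑' c : List 𝒳, Q a c = 1)
    (N₀ : ℕ) (hbdd : ∀ a (c : List 𝒳), N₀ < c.length → Q a c = 0)
    (hirr : ∀ a b, ∃ k : ℕ, 0 < k ∧ 0 < (gwA Q ^ k) a b)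
    (π : 𝒳 → ℝ) (hπ0 : ∀ a, 0 ≤ π a) (hπ1 : ∑ a, π a = 1)
    (hcrit : ∀ a, ∑ b, gwA Q a b * π b = π a)
    (hZ : ∀ n : ℕ, 1 ≤ n → 0 < Zn μ Q n) :
    ∀ ε > 0, Filter.Tendsto (fun n : ℕ => condPr μ Q n
      {t : GWTree 𝒳 | ε ≤ |(-(1/(n:ℝ)) * Real.log (μ t.root * GWTree.wt Q t / Zn μ Q n))
        + ∑' pc : 𝒳 × List 𝒳, π pc.1 * Q pc.1 pc.2 * Real.log (Q pc.1 pc.2)|})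
      Filter.atTop (nhds 0) := by
  intro ε hε
  have hS : ∀ a c, c ∉ (List.finite_length_le 𝒳 N₀).toFinset → Q a c = 0 := fun a c hc =>
    hbdd a c (by simpa using hc)
  have hpos : ∀ a, 0 < π a := by
    obtain ⟨a, -, ha⟩ := Finset.exists_ne_zero_of_sum_ne_zero (hπ1 ▸ one_ne_zero :
      ∑ a, π a ≠ 0)
    exact eigenvector_pos (IsCriticalKernel.gwA_nonneg hQ0) hirr hπ0 hcrit
      ((hπ0 a).lt_of_ne' ha)
  have hchild : ∃ a, 0 < Q a [] := by
    by_contra! hno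
    refine (hZ 1 le_rfl).ne' ?_
    rw [Zn, tsum_congr fun t => ?_, tsum_zero]
    obtain ⟨a, ts⟩ := t
    split_ifs with hsize
    · cases ts with
      | nil =>
        rw [GWTree.wt_node, List.map_nil, (hno a).antisymm (hQ0 _ _), zero_mul, mul_zero]
      | cons t ts =>
        rw [GWTree.size_node, List.map_cons, List.sum_cons] at hsize
        have : 0 < t.size := by
          obtain ⟨b, us⟩ := t
          rw [GWTree.size_node]
          omega
        omega
    · rfl
  have h : IsCriticalKernel Q (List.finite_length_le 𝒳 N₀).toFinset π :=
    { nonneg := hQ0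
      support := hS
      sum_eq_one := fun a => by rw [← hQ1 a, tsum_eq_sum fun c hc => hS a c hc]
      irreducible := hirr
      pos := hpos
      sum_p := hπ1
      critical := hcrit
      childless := hchild }
  refine h.tendsto_condPr hμ0 hμ1 hZ ?_ hε
  rw [tsum_eq_sum (s := Finset.univ ×ˢ (List.finite_length_le 𝒳 N₀).toFinset),
    Finset.sum_product]
  · simp only [Finset.mul_sum, mul_assoc]
  · rintro ⟨a, c⟩ hc
    rw [hS a c (by simpa using hc)]
    simp
end
end

section
/- Let X be a coloured random graph with n vertices, colour law μ : 𝒳 → (0,1], and connection probabilities p_n satisfying a_n^{-1}·p_n(a,b) → C(a,b) for all a,b ∈ 𝒳, for some symmetric C : 𝒳×𝒳 → [0,∞) and a sequence (a_n) with a_n·n·log n → ∞ and (log a_n)/(log n) → −1. Then for every ε > 0, lim_{n→∞} ℙ_n{ | −(1/(a_n·n²·log n))·log P_n(X) − (1/2)·Σ_{a,b∈𝒳} μ(a)·C(a,b)·μ(b) | ≥ ε } = 0. -/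
open Filter
open scoped ENNReal

noncomputable section

namespace CRG

variable {𝒳 : Type} [Fintype 𝒳] [DecidableEq 𝒳]

/-- The set `ℰ` of formally ordered potential edges on `{1,…,n}`. -/
abbrev Edges (n : ℕ) : Finset (Fin n × Fin n) :=
  Finset.univ.filter (fun e : Fin n × Fin n => e.1 < e.2)

/-- The probability weight `P_n(x)` of a coloured graph `x` (colouring, edge set) under the
coloured random graph law with colour law `μ` and connection probabilities `p`. -/
def graphWeight (μ : 𝒳 → ℝ) (p : 𝒳 → 𝒳 → ℝ) (n : ℕ)
    (x : (Fin n → 𝒳) × Finset (Fin n × Fin n)) : ℝ :=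
  (if x.2 ⊆ Edges n then 1 else 0) *
  (∏ v, μ (x.1 v)) *
  ∏ e ∈ Edges n, (if e ∈ x.2 then p (x.1 e.1) (x.1 e.2) else 1 - p (x.1 e.1) (x.1 e.2))

/-- The probability `ℙ_n(S)` of an event `S` under the coloured random graph law. -/
def graphPr (μ : 𝒳 → ℝ) (p : 𝒳 → 𝒳 → ℝ) (n : ℕ)
    (S : Set ((Fin n → 𝒳) × Finset (Fin n × Fin n))) : ℝ :=
  ∑ x, S.indicator (graphWeight μ p n) x

/-- The empirical colour measure `L¹`. -/
def L1 (n : ℕ) (x : (Fin n → 𝒳) × Finset (Fin n × Fin n)) (a : 𝒳) : ℝ :=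
  ((Finset.univ.filter (fun v : Fin n => x.1 v = a)).card : ℝ) / n

/-- The empirical pair measure `L²` (scaled by `1/(n² aₙ)`). -/
def L2 (an : ℝ) (n : ℕ) (x : (Fin n → 𝒳) × Finset (Fin n × Fin n)) (q : 𝒳 × 𝒳) : ℝ :=
  (∑ e ∈ x.2, ((if (x.1 e.1, x.1 e.2) = q then (1:ℝ) else 0)
    + (if (x.1 e.2, x.1 e.1) = q then (1:ℝ) else 0))) / ((n:ℝ)^2 * an)

/-- Extended-real logarithm, `log 0 = -∞`. -/
def elog (x : ℝ) : EReal := if x ≤ 0 then ⊥ else ((Real.log x : ℝ) : EReal)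

/-- `ℳ(𝒳) × ℳ̃_*(𝒳×𝒳)`: probability vectors paired with finite symmetric measures,
viewed inside `ℝ^𝒳 × ℝ^(𝒳×𝒳)`. -/
def MSpace (𝒳 : Type) [Fintype 𝒳] : Set ((𝒳 → ℝ) × (𝒳 × 𝒳 → ℝ)) :=
  {z | (∀ a, 0 ≤ z.1 a) ∧ (∑ a, z.1 a) = 1 ∧ (∀ q, 0 ≤ z.2 q) ∧ ∀ a b, z.2 (a,b) = z.2 (b,a)}

open Classical in
/-- Relative entropy `H(ν‖ρ)` of measures on a finite set, `+∞` if `ν` is not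
absolutely continuous w.r.t. `ρ`. -/
def relEnt (ν ρ : 𝒳 → ℝ) : ℝ≥0∞ :=
  if ∀ x, ρ x = 0 → ν x = 0 then
    ENNReal.ofReal (∑ x, ν x * Real.log (ν x / ρ x)) else ⊤

open Classical in
/-- `𝔥_C(ϖ‖ω) = H(ϖ‖Cω⊗ω) + ‖Cω⊗ω‖ − ‖ϖ‖`. -/
def hRel (C : 𝒳 → 𝒳 → ℝ) (ω : 𝒳 → ℝ) (ϖ : 𝒳 × 𝒳 → ℝ) : ℝ≥0∞ :=
  if ∀ q : 𝒳 × 𝒳, C q.1 q.2 * ω q.1 * ω q.2 = 0 → ϖ q = 0 then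
    ENNReal.ofReal ((∑ q : 𝒳 × 𝒳, ϖ q * Real.log (ϖ q / (C q.1 q.2 * ω q.1 * ω q.2)))
      + (∑ q : 𝒳 × 𝒳, C q.1 q.2 * ω q.1 * ω q.2) - ∑ q : 𝒳 × 𝒳, ϖ q)
  else ⊤

end CRG

open CRG

namespace CRG

/-- Second moment of a shifted, centred sum over independent Bernoulli indicators. -/
lemma sum_powerset_bernoulli_sq {ι : Type*} [DecidableEq ι] (s : Finset ι) (q w : ι → ℝ) (t : ℝ) :
    ∑ E ∈ s.powerset, (∏ e ∈ s, if e ∈ E then q e else 1 - q e) *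
        (t + ∑ e ∈ s, ((if e ∈ E then 1 else 0) - q e) * w e) ^ 2
      = t ^ 2 + ∑ e ∈ s, q e * (1 - q e) * w e ^ 2 := by
  induction s using Finset.induction_on generalizing t with
  | empty => simp
  | insert i s hi ih =>
    have hne : ∀ e ∈ s, e ≠ i := fun e he h => hi (h ▸ he)
    have hout : ∀ E ∈ s.powerset,
        (∏ e ∈ insert i s, if e ∈ E then q e else 1 - q e) *
          (t + ∑ e ∈ insert i s, ((if e ∈ E then 1 else 0) - q e) * w e) ^ 2
        = (1 - q i) * ((∏ e ∈ s, if e ∈ E then q e else 1 - q e) *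
          ((t - q i * w i) + ∑ e ∈ s, ((if e ∈ E then 1 else 0) - q e) * w e) ^ 2) := by
      intro E hE
      have hiE : i ∉ E := fun h => hi (Finset.mem_powerset.1 hE h)
      rw [Finset.prod_insert hi, Finset.sum_insert hi, if_neg hiE, if_neg hiE]
      ring
    have hin : ∀ E ∈ s.powerset,
        (∏ e ∈ insert i s, if e ∈ insert i E then q e else 1 - q e) *
          (t + ∑ e ∈ insert i s, ((if e ∈ insert i E then 1 else 0) - q e) * w e) ^ 2
        = q i * ((∏ e ∈ s, if e ∈ E then q e else 1 - q e) *
          ((t + (1 - q i) * w i) + ∑ e ∈ s, ((if e ∈ E then 1 else 0) - q e) * w e) ^ 2) := by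
      intro E _
      have h1 : (∏ e ∈ s, if e ∈ insert i E then q e else 1 - q e)
          = ∏ e ∈ s, if e ∈ E then q e else 1 - q e :=
        Finset.prod_congr rfl fun e he => by simp [Finset.mem_insert, hne e he]
      have h2 : (∑ e ∈ s, ((if e ∈ insert i E then 1 else 0) - q e) * w e)
          = ∑ e ∈ s, ((if e ∈ E then 1 else 0) - q e) * w e :=
        Finset.sum_congr rfl fun e he => by simp [Finset.mem_insert, hne e he]
      rw [Finset.prod_insert hi, Finset.sum_insert hi, h1, h2,
        if_pos (Finset.mem_insert_self i E), if_pos (Finset.mem_insert_self i E)]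
      ring
    rw [Finset.sum_powerset_insert hi, Finset.sum_congr rfl hout, Finset.sum_congr rfl hin,
      ← Finset.mul_sum, ← Finset.mul_sum, ih, ih, Finset.sum_insert hi]
    ring

lemma sum_powerset_bernoulli {ι : Type*} [DecidableEq ι] (s : Finset ι) (q : ι → ℝ) :
    ∑ E ∈ s.powerset, (∏ e ∈ s, if e ∈ E then q e else 1 - q e) = 1 := by
  simpa using sum_powerset_bernoulli_sq s q (fun _ => 0) 1

/-- Second moment of a shifted sum of centred i.i.d. random variables. -/
lemma sum_pi_iid_sq {𝒳 : Type*} [Fintype 𝒳] (μ g : 𝒳 → ℝ)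
    (hμ : ∑ a, μ a = 1) (hg : ∑ a, μ a * g a = 0) (n : ℕ) (t : ℝ) :
    ∑ c : Fin n → 𝒳, (∏ v, μ (c v)) * (t + ∑ v, g (c v)) ^ 2
      = t ^ 2 + n * ∑ a, μ a * g a ^ 2 := by
  induction n generalizing t with
  | zero => simp
  | succ n ih =>
    rw [← (Fin.consEquiv fun _ : Fin (n + 1) => 𝒳).sum_comp, Fintype.sum_prod_type]
    have h : ∀ x : 𝒳, ∑ y : Fin n → 𝒳,
        (∏ v, μ ((Fin.consEquiv fun _ : Fin (n + 1) => 𝒳) (x, y) v)) *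
          (t + ∑ v, g ((Fin.consEquiv fun _ : Fin (n + 1) => 𝒳) (x, y) v)) ^ 2
        = t ^ 2 * μ x + 2 * t * (μ x * g x) + μ x * g x ^ 2
          + (n * ∑ a, μ a * g a ^ 2) * μ x := by
      intro x
      calc _ = ∑ y : Fin n → 𝒳, μ x * ((∏ v, μ (y v)) * ((t + g x) + ∑ v, g (y v)) ^ 2) := by
            refine Finset.sum_congr rfl fun y _ => ?_
            simp only [Fin.consEquiv_apply, Fin.prod_univ_succ, Fin.sum_univ_succ, Fin.cons_zero,
              Fin.cons_succ]
            ring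
        _ = _ := by rw [← Finset.mul_sum, ih]; ring
    simp only [h, Finset.sum_add_distrib, ← Finset.mul_sum, hμ, hg]
    push_cast
    ring

lemma sum_pi_iid {𝒳 : Type*} [Fintype 𝒳] (μ : 𝒳 → ℝ) (hμ : ∑ a, μ a = 1) (n : ℕ) :
    ∑ c : Fin n → 𝒳, ∏ v, μ (c v) = 1 := by
  simpa using sum_pi_iid_sq μ (fun _ => 0) hμ (by simp) n 1

lemma graphWeight_nonneg {𝒳 : Type} {μ : 𝒳 → ℝ} {p : 𝒳 → 𝒳 → ℝ}
    (hμ0 : ∀ a, 0 ≤ μ a) (hp0 : ∀ a b, 0 ≤ p a b) (hp1 : ∀ a b, p a b ≤ 1) (n : ℕ)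
    (x : (Fin n → 𝒳) × Finset (Fin n × Fin n)) : 0 ≤ graphWeight μ p n x := by
  unfold graphWeight
  refine mul_nonneg (mul_nonneg (by split_ifs <;> norm_num) ?_) ?_
  · exact Finset.prod_nonneg fun v _ => hμ0 _
  · refine Finset.prod_nonneg fun e _ => ?_
    split_ifs
    · exact hp0 _ _
    · exact sub_nonneg.2 (hp1 _ _)

/-- Expectations under the coloured random graph law, conditioning on the colours first. -/
lemma sum_graphWeight_mul {𝒳 : Type} [Fintype 𝒳] (μ : 𝒳 → ℝ) (p : 𝒳 → 𝒳 → ℝ) (n : ℕ)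
    (F : (Fin n → 𝒳) × Finset (Fin n × Fin n) → ℝ) :
    ∑ x, graphWeight μ p n x * F x = ∑ c : Fin n → 𝒳, (∏ v, μ (c v)) *
      ∑ E ∈ (Edges n).powerset,
        (∏ e ∈ Edges n, if e ∈ E then p (c e.1) (c e.2) else 1 - p (c e.1) (c e.2)) * F (c, E) := by
  rw [Fintype.sum_prod_type]
  refine Finset.sum_congr rfl fun c _ => ?_
  rw [Finset.mul_sum, ← Finset.sum_subset (Finset.subset_univ (Edges n).powerset)]
  · refine Finset.sum_congr rfl fun E hE => ?_
    simp only [graphWeight]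
    rw [if_pos (Finset.mem_powerset.1 hE)]
    ring
  · intro E _ hE
    simp only [graphWeight]
    rw [if_neg fun h => hE (Finset.mem_powerset.2 h)]
    ring

/-- Centred sum of `-log p` over the edges of `x`, up to sign. -/
def edgeFluct {𝒳 : Type} (p : 𝒳 → 𝒳 → ℝ) (n : ℕ)
    (x : (Fin n → 𝒳) × Finset (Fin n × Fin n)) : ℝ :=
  ∑ e ∈ Edges n, ((if e ∈ x.2 then 1 else 0) - p (x.1 e.1) (x.1 e.2)) *
    Real.log (p (x.1 e.1) (x.1 e.2))

lemma card_edges_le (n : ℕ) : ((Edges n).card : ℝ) ≤ (n : ℝ) ^ 2 := by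
  have h := Finset.card_filter_le (Finset.univ : Finset (Fin n × Fin n)) (fun e => e.1 < e.2)
  have h' : (Edges n).card ≤ n ^ 2 := h.trans (by simp [sq])
  exact_mod_cast h'

lemma sum_graphWeight_edgeFluct_sq_le {𝒳 : Type} [Fintype 𝒳] {μ : 𝒳 → ℝ} {p : 𝒳 → 𝒳 → ℝ}
    (hμ0 : ∀ a, 0 ≤ μ a) (hμs : ∑ a, μ a = 1) {B : ℝ} (hB0 : 0 ≤ B) (hB : ∀ a b, p a b * Real.log (p a b) ^ 2 ≤ B) (n : ℕ) :
    ∑ x, graphWeight μ p n x * edgeFluct p n x ^ 2 ≤ (n : ℝ) ^ 2 * B := by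
  rw [sum_graphWeight_mul]
  have h : ∀ c : Fin n → 𝒳, ∑ E ∈ (Edges n).powerset,
      (∏ e ∈ Edges n, if e ∈ E then p (c e.1) (c e.2) else 1 - p (c e.1) (c e.2)) *
        edgeFluct p n (c, E) ^ 2 ≤ (n : ℝ) ^ 2 * B := by
    intro c
    have h1 := sum_powerset_bernoulli_sq (Edges n) (fun e => p (c e.1) (c e.2))
      (fun e => Real.log (p (c e.1) (c e.2))) 0
    simp only [zero_add] at h1
    simp only [edgeFluct]
    rw [h1]
    calc _ ≤ ∑ e ∈ Edges n, B := by
          simp only [ne_eq, OfNat.ofNat_ne_zero, not_false_eq_true, zero_pow, zero_add]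
          refine Finset.sum_le_sum fun e _ => ?_
          nlinarith [hB (c e.1) (c e.2), sq_nonneg (p (c e.1) (c e.2) *
            Real.log (p (c e.1) (c e.2)))]
      _ = (Edges n).card * B := by simp
      _ ≤ _ := mul_le_mul_of_nonneg_right (card_edges_le n) hB0
  calc _ ≤ ∑ c : Fin n → 𝒳, (∏ v, μ (c v)) * ((n : ℝ) ^ 2 * B) :=
        Finset.sum_le_sum fun c _ => mul_le_mul_of_nonneg_left (h c)
          (Finset.prod_nonneg fun v _ => hμ0 _)
    _ = _ := by rw [← Finset.sum_mul, sum_pi_iid μ hμs, one_mul]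

lemma L1_eq_sum {𝒳 : Type} [DecidableEq 𝒳] (n : ℕ)
    (x : (Fin n → 𝒳) × Finset (Fin n × Fin n)) (a : 𝒳) :
    L1 n x a = (∑ v, if x.1 v = a then (1 : ℝ) else 0) / n := by
  simp [L1]

lemma sum_graphWeight_L1_sub_sq_le {𝒳 : Type} [Fintype 𝒳] [DecidableEq 𝒳] {μ : 𝒳 → ℝ}
    (p : 𝒳 → 𝒳 → ℝ) (hμs : ∑ a, μ a = 1) (hμ0 : ∀ a, 0 ≤ μ a) {n : ℕ} (hn : 0 < n) (a : 𝒳) :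
    ∑ x, graphWeight μ p n x * (L1 n x a - μ a) ^ 2 ≤ 1 / n := by
  have hn' : (0 : ℝ) < n := by exact_mod_cast hn
  have hL : ∀ (c : Fin n → 𝒳) E, (L1 n (c, E) a - μ a) ^ 2
      = (0 + ∑ v, ((if c v = a then 1 else 0) - μ a)) ^ 2 / (n : ℝ) ^ 2 := by
    intro c E
    rw [L1_eq_sum, ← div_pow, Finset.sum_sub_distrib]
    congr 1
    simp only [Finset.sum_const, Finset.card_univ, Fintype.card_fin, nsmul_eq_mul]
    field_simp
    ring
  have h1 : ∑ b, μ b * (if b = a then (1 : ℝ) else 0) = μ a := by simp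
  have hg : ∑ b, μ b * ((if b = a then 1 else 0) - μ a) = 0 := by
    simp only [mul_sub, Finset.sum_sub_distrib, h1, ← Finset.sum_mul, hμs]
    ring
  have hg2 : ∑ b, μ b * ((if b = a then 1 else 0) - μ a) ^ 2 ≤ 1 := by
    have hμ1 : μ a ≤ 1 := hμs ▸ Finset.single_le_sum (fun b _ => hμ0 b) (Finset.mem_univ a)
    calc _ ≤ ∑ b, μ b := by
          refine Finset.sum_le_sum fun b _ => mul_le_of_le_one_right (hμ0 b) ?_
          have := hμ0 a
          split_ifs <;> nlinarith
      _ = 1 := hμs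
  rw [sum_graphWeight_mul]
  simp only [hL, ← Finset.sum_mul, sum_powerset_bernoulli, one_mul, ← mul_div_assoc,
    ← Finset.sum_div]
  rw [sum_pi_iid_sq μ _ hμs hg n 0, div_le_div_iff₀ (by positivity) hn']
  nlinarith

lemma log_graphWeight_eq {𝒳 : Type} {μ : 𝒳 → ℝ} {p : 𝒳 → 𝒳 → ℝ} {n : ℕ}
    {x : (Fin n → 𝒳) × Finset (Fin n × Fin n)} (hx : graphWeight μ p n x ≠ 0) :
    Real.log (graphWeight μ p n x) = (∑ v, Real.log (μ (x.1 v))) + edgeFluct p n x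
      + (∑ e ∈ Edges n, p (x.1 e.1) (x.1 e.2) * Real.log (p (x.1 e.1) (x.1 e.2)))
      + ∑ e ∈ Edges n, if e ∈ x.2 then 0 else Real.log (1 - p (x.1 e.1) (x.1 e.2)) := by
  unfold graphWeight at hx ⊢
  obtain ⟨h12, h3⟩ := mul_ne_zero_iff.1 hx
  obtain ⟨h1, h2⟩ := mul_ne_zero_iff.1 h12
  have hsub : x.2 ⊆ Edges n := by
    by_contra h
    exact h1 (if_neg h)
  rw [if_pos hsub] at h12 ⊢
  rw [Real.log_mul h12 h3, one_mul, Real.log_prod (Finset.prod_ne_zero_iff.1 h2),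
    Real.log_prod (Finset.prod_ne_zero_iff.1 h3), edgeFluct, add_assoc, add_assoc,
    ← Finset.sum_add_distrib, ← Finset.sum_add_distrib]
  congr 1
  refine Finset.sum_congr rfl fun e _ => ?_
  split_ifs <;> ring

lemma sum_edges_symm {n : ℕ} (G : Fin n → Fin n → ℝ) (hG : ∀ u v, G u v = G v u) :
    ∑ u, ∑ v, G u v = 2 * (∑ e ∈ Edges n, G e.1 e.2) + ∑ v, G v v := by
  have hlt : ∑ e ∈ Edges n, G e.1 e.2 = ∑ u, ∑ v, if u < v then G u v else 0 := by
    rw [Finset.sum_filter, Fintype.sum_prod_type]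
  have hgt : ∑ e ∈ Edges n, G e.1 e.2 = ∑ u, ∑ v, if v < u then G u v else 0 := by
    rw [hlt, Finset.sum_comm]
    simp only [hG]
  have heq : ∑ v, G v v = ∑ u, ∑ v, if u = v then G u v else 0 := by simp
  rw [two_mul]
  nth_rewrite 1 [hlt]
  rw [hgt, heq]
  simp only [← Finset.sum_add_distrib]
  refine Finset.sum_congr rfl fun u _ => Finset.sum_congr rfl fun v _ => ?_
  rcases lt_trichotomy u v with h | h | h
  · simp [h, h.not_gt, h.ne]
  · simp [h]
  · simp [h, h.not_gt, h.ne']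

lemma sum_sum_colour_eq {𝒳 : Type} [Fintype 𝒳] [DecidableEq 𝒳] (C : 𝒳 → 𝒳 → ℝ) {n : ℕ}
    (hn : 0 < n) (x : (Fin n → 𝒳) × Finset (Fin n × Fin n)) :
    ∑ u, ∑ v, C (x.1 u) (x.1 v)
      = (n : ℝ) ^ 2 * ∑ q : 𝒳 × 𝒳, L1 n x q.1 * C q.1 q.2 * L1 n x q.2 := by
  have hn' : (n : ℝ) ≠ 0 := by exact_mod_cast hn.ne'
  have hs : ∀ (f : 𝒳 → ℝ), ∑ v, f (x.1 v) = n * ∑ a, L1 n x a * f a := by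
    intro f
    have h : ∀ a, L1 n x a * f a = (∑ v, if x.1 v = a then f a else 0) / n := by
      intro a
      rw [L1_eq_sum, div_mul_eq_mul_div, Finset.sum_mul]
      simp
    simp only [h, ← Finset.sum_div]
    rw [Finset.sum_comm, mul_div_cancel₀ _ hn']
    simp
  rw [Fintype.sum_prod_type]
  simp only [hs, ← Finset.mul_sum]
  rw [hs fun u => ∑ b, L1 n x b * C u b, ← mul_assoc, ← sq]
  congr 1
  refine Finset.sum_congr rfl fun a _ => ?_
  rw [Finset.mul_sum]
  exact Finset.sum_congr rfl fun b _ => by ring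

lemma L1_nonneg {𝒳 : Type} [DecidableEq 𝒳] (n : ℕ)
    (x : (Fin n → 𝒳) × Finset (Fin n × Fin n)) (a : 𝒳) : 0 ≤ L1 n x a := by
  unfold L1
  positivity

lemma L1_le_one {𝒳 : Type} [DecidableEq 𝒳] (n : ℕ)
    (x : (Fin n → 𝒳) × Finset (Fin n × Fin n)) (a : 𝒳) : L1 n x a ≤ 1 := by
  unfold L1
  refine div_le_one_of_le₀ ?_ (Nat.cast_nonneg n)
  have h := Finset.card_filter_le (Finset.univ : Finset (Fin n)) (fun v => x.1 v = a)
  rw [Finset.card_univ, Fintype.card_fin] at h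
  exact_mod_cast h

lemma abs_sum_edges_colour_sub_le {𝒳 : Type} [Fintype 𝒳] [DecidableEq 𝒳] {μ : 𝒳 → ℝ}
    (hμ0 : ∀ a, 0 ≤ μ a) (hμ1 : ∀ a, μ a ≤ 1) {C : 𝒳 → 𝒳 → ℝ} {K : ℝ}
    (hCsymm : ∀ a b, C a b = C b a) (hC : ∀ a b, |C a b| ≤ K) {n : ℕ} (hn : 0 < n)
    (x : (Fin n → 𝒳) × Finset (Fin n × Fin n)) :
    |(∑ e ∈ Edges n, C (x.1 e.1) (x.1 e.2)) / (n : ℝ) ^ 2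
        - (1 / 2) * ∑ q : 𝒳 × 𝒳, μ q.1 * C q.1 q.2 * μ q.2|
      ≤ K / n + K * Fintype.card 𝒳 * ∑ a, |L1 n x a - μ a| := by
  have hn' : (0 : ℝ) < n := by exact_mod_cast hn
  have h1 := sum_edges_symm (fun u v => C (x.1 u) (x.1 v)) (fun u v => hCsymm _ _)
  rw [sum_sum_colour_eq C hn x] at h1
  have hdiag : |∑ v, C (x.1 v) (x.1 v)| ≤ n * K := by
    calc _ ≤ ∑ v, |C (x.1 v) (x.1 v)| := Finset.abs_sum_le_sum_abs _ _
      _ ≤ ∑ _v : Fin n, K := Finset.sum_le_sum fun v _ => hC _ _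
      _ = _ := by simp
  have hpair : |∑ q : 𝒳 × 𝒳, L1 n x q.1 * C q.1 q.2 * L1 n x q.2
      - ∑ q : 𝒳 × 𝒳, μ q.1 * C q.1 q.2 * μ q.2|
      ≤ 2 * (K * Fintype.card 𝒳 * ∑ a, |L1 n x a - μ a|) := by
    rw [← Finset.sum_sub_distrib]
    calc _ ≤ ∑ q : 𝒳 × 𝒳, |L1 n x q.1 * C q.1 q.2 * L1 n x q.2 - μ q.1 * C q.1 q.2 * μ q.2| :=
          Finset.abs_sum_le_sum_abs _ _
      _ ≤ ∑ q : 𝒳 × 𝒳, K * (|L1 n x q.1 - μ q.1| + |L1 n x q.2 - μ q.2|) := by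
          refine Finset.sum_le_sum fun q _ => ?_
          have hd : L1 n x q.1 * C q.1 q.2 * L1 n x q.2 - μ q.1 * C q.1 q.2 * μ q.2
              = C q.1 q.2 * ((L1 n x q.1 - μ q.1) * L1 n x q.2
                + μ q.1 * (L1 n x q.2 - μ q.2)) := by ring
          rw [hd, abs_mul]
          refine mul_le_mul (hC _ _) ((abs_add_le _ _).trans ?_) (abs_nonneg _)
            ((abs_nonneg _).trans (hC q.1 q.2))
          rw [abs_mul, abs_mul, abs_of_nonneg (L1_nonneg n x q.2), abs_of_nonneg (hμ0 q.1)]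
          exact add_le_add (mul_le_of_le_one_right (abs_nonneg _) (L1_le_one n x q.2))
            (mul_le_of_le_one_left (abs_nonneg _) (hμ1 q.1))
      _ = _ := by
          rw [← Finset.mul_sum, Finset.sum_add_distrib, Fintype.sum_prod_type,
            Fintype.sum_prod_type]
          simp only [Finset.sum_const, Finset.card_univ, nsmul_eq_mul, ← Finset.mul_sum]
          ring
  set P := ∑ q : 𝒳 × 𝒳, L1 n x q.1 * C q.1 q.2 * L1 n x q.2
  set Q := ∑ q : 𝒳 × 𝒳, μ q.1 * C q.1 q.2 * μ q.2
  set d := ∑ v, C (x.1 v) (x.1 v)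
  have h2 : (∑ e ∈ Edges n, C (x.1 e.1) (x.1 e.2)) / (n : ℝ) ^ 2 - (1 / 2) * Q
      = (P - Q) / 2 - d / (2 * (n : ℝ) ^ 2) := by
    field_simp
    linarith
  have h3 : |d / (2 * (n : ℝ) ^ 2)| ≤ K / n := by
    rw [abs_div, abs_of_pos (by positivity : (0 : ℝ) < 2 * (n : ℝ) ^ 2),
      div_le_div_iff₀ (by positivity) hn']
    have := mul_le_mul_of_nonneg_right hdiag hn'.le
    nlinarith [abs_nonneg d]
  have h4 : |(P - Q) / 2| ≤ K * Fintype.card 𝒳 * ∑ a, |L1 n x a - μ a| := by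
    rw [abs_div, abs_two]
    linarith
  rw [h2]
  exact (abs_sub _ _).trans (by linarith)

lemma abs_sum_edges_le {n : ℕ} {f : Fin n × Fin n → ℝ} {m : ℝ} (hm : 0 ≤ m)
    (hf : ∀ e, |f e| ≤ m) : |∑ e ∈ Edges n, f e| ≤ (n : ℝ) ^ 2 * m :=
  calc _ ≤ ∑ e ∈ Edges n, |f e| := Finset.abs_sum_le_sum_abs _ _
    _ ≤ ∑ _e ∈ Edges n, m := Finset.sum_le_sum fun e _ => hf e
    _ = (Edges n).card * m := by simp
    _ ≤ _ := mul_le_mul_of_nonneg_right (card_edges_le n) hm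

/-- Deterministic control of the normalised log-likelihood by the edge fluctuation and the
deviation of the empirical colour measure. -/
lemma abs_log_graphWeight_sub_le {𝒳 : Type} [Fintype 𝒳] [DecidableEq 𝒳] {μ : 𝒳 → ℝ}
    (hμ0 : ∀ a, 0 ≤ μ a) (hμ1 : ∀ a, μ a ≤ 1) {p C : 𝒳 → 𝒳 → ℝ} {K M m η D : ℝ}
    (hCsymm : ∀ a b, C a b = C b a) (hC : ∀ a b, |C a b| ≤ K)
    (hM : ∀ a, |Real.log (μ a)| ≤ M) (hm0 : 0 ≤ m) (hm : ∀ a b, |Real.log (1 - p a b)| ≤ m)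
    {n : ℕ} (hn : 0 < n) (hD : 0 < D) (hη0 : 0 ≤ η)
    (hη : ∀ a b, |p a b * Real.log (p a b) * ((n : ℝ) ^ 2 / D) + C a b| ≤ η)
    {x : (Fin n → 𝒳) × Finset (Fin n × Fin n)} (hx : graphWeight μ p n x ≠ 0) :
    |-(1 / D) * Real.log (graphWeight μ p n x)
        - (1 / 2) * ∑ q : 𝒳 × 𝒳, μ q.1 * C q.1 q.2 * μ q.2|
      ≤ (n * M / D + η + (n : ℝ) ^ 2 * m / D + K / n) + (|edgeFluct p n x| / D
        + K * Fintype.card 𝒳 * ∑ a, |L1 n x a - μ a|) := by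
  have hn' : (0 : ℝ) < n := by exact_mod_cast hn
  have h1 : |∑ v, Real.log (μ (x.1 v))| ≤ n * M := by
    calc _ ≤ ∑ v, |Real.log (μ (x.1 v))| := Finset.abs_sum_le_sum_abs _ _
      _ ≤ ∑ _v : Fin n, M := Finset.sum_le_sum fun v _ => hM _
      _ = _ := by simp
  have h2 : |∑ e ∈ Edges n, if e ∈ x.2 then 0 else Real.log (1 - p (x.1 e.1) (x.1 e.2))|
      ≤ (n : ℝ) ^ 2 * m := by
    refine abs_sum_edges_le hm0 fun e => ?_
    split_ifs
    · simpa using hm0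
    · exact hm _ _
  have h3 : |∑ e ∈ Edges n, (p (x.1 e.1) (x.1 e.2) * Real.log (p (x.1 e.1) (x.1 e.2))
      * ((n : ℝ) ^ 2 / D) + C (x.1 e.1) (x.1 e.2))| ≤ (n : ℝ) ^ 2 * η :=
    abs_sum_edges_le hη0 fun e => hη _ _
  have h4 := abs_sum_edges_colour_sub_le hμ0 hμ1 hCsymm hC hn x
  rw [Finset.sum_add_distrib, ← Finset.sum_mul] at h3
  rw [log_graphWeight_eq hx]
  set A1 := ∑ v, Real.log (μ (x.1 v))
  set A2 := ∑ e ∈ Edges n, if e ∈ x.2 then 0 else Real.log (1 - p (x.1 e.1) (x.1 e.2))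
  set A3 := ∑ e ∈ Edges n, p (x.1 e.1) (x.1 e.2) * Real.log (p (x.1 e.1) (x.1 e.2))
  set A4 := ∑ e ∈ Edges n, C (x.1 e.1) (x.1 e.2)
  set T := edgeFluct p n x
  set Q := ∑ q : 𝒳 × 𝒳, μ q.1 * C q.1 q.2 * μ q.2
  have hsplit : -(1 / D) * (A1 + T + A3 + A2) - (1 / 2) * Q
      = -(A1 / D) - T / D - A2 / D - (A3 * ((n : ℝ) ^ 2 / D) + A4) / (n : ℝ) ^ 2
        + (A4 / (n : ℝ) ^ 2 - (1 / 2) * Q) := by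
    field_simp
    ring
  have b1 : |A1 / D| ≤ n * M / D := by
    rw [abs_div, abs_of_pos hD]
    gcongr
  have b2 : |A2 / D| ≤ (n : ℝ) ^ 2 * m / D := by
    rw [abs_div, abs_of_pos hD]
    gcongr
  have b3 : |(A3 * ((n : ℝ) ^ 2 / D) + A4) / (n : ℝ) ^ 2| ≤ η := by
    rw [abs_div, abs_of_pos (by positivity : (0 : ℝ) < (n : ℝ) ^ 2), div_le_iff₀ (by positivity)]
    linarith
  have b4 : |T / D| = |T| / D := by rw [abs_div, abs_of_pos hD]
  rw [hsplit]
  rw [abs_le] at b1 b2 b3 h4 ⊢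
  have b5 := abs_le.1 b4.le
  constructor <;> linarith [b1.1, b1.2, b2.1, b2.2, b3.1, b3.2, h4.1, h4.2, b5.1, b5.2]

/-- Chebyshev bound for the deviation of the normalised log-likelihood. -/
lemma graphPr_log_graphWeight_le {𝒳 : Type} [Fintype 𝒳] [DecidableEq 𝒳] {μ : 𝒳 → ℝ}
    (hμ0 : ∀ a, 0 ≤ μ a) (hμs : ∑ a, μ a = 1) {p C : 𝒳 → 𝒳 → ℝ} {K M m η D B ε : ℝ}
    (hp0 : ∀ a b, 0 ≤ p a b) (hp1 : ∀ a b, p a b ≤ 1)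
    (hCsymm : ∀ a b, C a b = C b a) (hC : ∀ a b, |C a b| ≤ K)
    (hM : ∀ a, |Real.log (μ a)| ≤ M) (hm0 : 0 ≤ m) (hm : ∀ a b, |Real.log (1 - p a b)| ≤ m)
    {n : ℕ} (hn : 0 < n) (hD : 0 < D) (hη0 : 0 ≤ η)
    (hη : ∀ a b, |p a b * Real.log (p a b) * ((n : ℝ) ^ 2 / D) + C a b| ≤ η)
    (hB0 : 0 ≤ B) (hB : ∀ a b, p a b * Real.log (p a b) ^ 2 ≤ B) (hε : 0 < ε)
    (hsmall : n * M / D + η + (n : ℝ) ^ 2 * m / D + K / n ≤ ε / 2) :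
    graphPr μ p n {x | ε ≤ |-(1 / D) * Real.log (graphWeight μ p n x)
        - (1 / 2) * ∑ q : 𝒳 × 𝒳, μ q.1 * C q.1 q.2 * μ q.2|}
      ≤ 8 / ε ^ 2 * ((n : ℝ) ^ 2 * B / D ^ 2
        + (K * Fintype.card 𝒳) ^ 2 * Fintype.card 𝒳 * (Fintype.card 𝒳 * (1 / n))) := by
  have hμ1 : ∀ a, μ a ≤ 1 := fun a =>
    hμs ▸ Finset.single_le_sum (fun b _ => hμ0 b) (Finset.mem_univ a)
  set c := K * (Fintype.card 𝒳 : ℝ)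
  set k := (Fintype.card 𝒳 : ℝ)
  have key : ∀ x, Set.indicator {x | ε ≤ |-(1 / D) * Real.log (graphWeight μ p n x)
        - (1 / 2) * ∑ q : 𝒳 × 𝒳, μ q.1 * C q.1 q.2 * μ q.2|} (graphWeight μ p n) x
      ≤ 8 / ε ^ 2 * (graphWeight μ p n x * edgeFluct p n x ^ 2 / D ^ 2
        + c ^ 2 * k * ∑ a, graphWeight μ p n x * (L1 n x a - μ a) ^ 2) := by
    intro x
    have hW := graphWeight_nonneg hμ0 hp0 hp1 n x
    have hrhs : 0 ≤ 8 / ε ^ 2 * (graphWeight μ p n x * edgeFluct p n x ^ 2 / D ^ 2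
        + c ^ 2 * k * ∑ a, graphWeight μ p n x * (L1 n x a - μ a) ^ 2) := by
      have : 0 ≤ ∑ a, graphWeight μ p n x * (L1 n x a - μ a) ^ 2 :=
        Finset.sum_nonneg fun a _ => mul_nonneg hW (sq_nonneg _)
      positivity
    by_cases hx : graphWeight μ p n x = 0
    · refine le_trans (le_of_eq ?_) hrhs
      simp [Set.indicator_apply, hx]
    by_cases hmem : x ∈ {x | ε ≤ |-(1 / D) * Real.log (graphWeight μ p n x)
        - (1 / 2) * ∑ q : 𝒳 × 𝒳, μ q.1 * C q.1 q.2 * μ q.2|}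
    swap
    · rwa [Set.indicator_of_notMem hmem]
    rw [Set.indicator_of_mem hmem]
    have hdev := le_trans (show ε ≤ _ from hmem)
      (abs_log_graphWeight_sub_le hμ0 hμ1 hCsymm hC hM hm0 hm hn hD hη0 hη hx)
    set t := |edgeFluct p n x| / D with ht
    set s := ∑ a, |L1 n x a - μ a| with hs
    have hs2 : s ^ 2 ≤ k * ∑ a, (L1 n x a - μ a) ^ 2 := by
      have := sq_sum_le_card_mul_sum_sq (s := Finset.univ) (f := fun a => |L1 n x a - μ a|)
      simpa only [sq_abs, Finset.card_univ] using this
    have ht2 : t ^ 2 = edgeFluct p n x ^ 2 / D ^ 2 := by rw [ht, div_pow, sq_abs]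
    have h1 : ε / 2 ≤ t + c * s := by linarith
    have h2 : (ε / 2) ^ 2 ≤ 2 * (t ^ 2 + c ^ 2 * s ^ 2) := by
      have := pow_le_pow_left₀ (by positivity) h1 2
      nlinarith [sq_nonneg (t - c * s)]
    have h3 : ε ^ 2 ≤ 8 * (edgeFluct p n x ^ 2 / D ^ 2
        + c ^ 2 * k * ∑ a, (L1 n x a - μ a) ^ 2) := by
      rw [← ht2]
      nlinarith [mul_le_mul_of_nonneg_left hs2 (sq_nonneg c)]
    have h4 := mul_le_mul_of_nonneg_left h3 hW
    rw [← Finset.mul_sum, div_mul_eq_mul_div, le_div_iff₀ (by positivity)]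
    calc _ ≤ _ := h4
      _ = _ := by ring
  unfold graphPr
  calc _ ≤ _ := Finset.sum_le_sum fun x _ => key x
    _ = 8 / ε ^ 2 * ((∑ x, graphWeight μ p n x * edgeFluct p n x ^ 2) / D ^ 2
        + c ^ 2 * k * ∑ a, ∑ x, graphWeight μ p n x * (L1 n x a - μ a) ^ 2) := by
        rw [← Finset.mul_sum, Finset.sum_add_distrib, ← Finset.sum_div, ← Finset.mul_sum,
          Finset.sum_comm]
    _ ≤ _ := by
        have hL : ∑ a, ∑ x, graphWeight μ p n x * (L1 n x a - μ a) ^ 2 ≤ k * (1 / n) := by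
          calc _ ≤ ∑ _a : 𝒳, (1 / n : ℝ) := Finset.sum_le_sum fun a _ =>
                sum_graphWeight_L1_sub_sq_le p hμs hμ0 hn a
            _ = _ := by simp [k]
        have hT := sum_graphWeight_edgeFluct_sq_le hμ0 hμs hB0 hB n
        gcongr

lemma tendsto_mul_log_of_ratio {a p : ℕ → ℝ} {c : ℝ} (hapos : ∀ n, 0 < a n)
    (hr : Tendsto (fun n => p n / a n) atTop (nhds c))
    (hlog : Tendsto (fun n : ℕ => Real.log (a n) / Real.log n) atTop (nhds (-1))) :
    Tendsto (fun n : ℕ => p n * Real.log (p n) / (a n * Real.log n)) atTop (nhds (-c)) := by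
  have hL : Tendsto (fun n : ℕ => (Real.log n)⁻¹) atTop (nhds 0) :=
    (Real.tendsto_log_atTop.comp tendsto_natCast_atTop_atTop).inv_tendsto_atTop
  have h1 := (Real.continuous_mul_log.tendsto c).comp hr
  have h := (h1.mul hL).add (hr.mul hlog)
  simp only [mul_zero, zero_add, mul_neg, mul_one] at h
  refine h.congr fun n => ?_
  have ha := (hapos n).ne'
  obtain hp | hp := eq_or_ne (p n) 0
  · simp [hp]
  simp only [Function.comp, Real.log_div hp ha]
  obtain hl | hl := eq_or_ne (Real.log n) 0
  · simp [hl]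
  field_simp
  ring

lemma continuous_mul_log_sq : Continuous fun x : ℝ => |x| * Real.log x ^ 2 := by
  have h : (fun x : ℝ => |x| * Real.log x ^ 2)
      = fun x => 4 * (√|x| * Real.log (√|x|)) ^ 2 := by
    funext x
    rw [Real.log_sqrt (abs_nonneg x), Real.log_abs, mul_pow, Real.sq_sqrt (abs_nonneg x)]
    ring
  rw [h]
  exact continuous_const.mul
    ((Real.continuous_mul_log.comp (Real.continuous_sqrt.comp continuous_abs)).pow 2)

lemma tendsto_mul_log_sq_of_ratio {a p : ℕ → ℝ} {c : ℝ} (hapos : ∀ n, 0 < a n)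
    (hp0 : ∀ n, 0 ≤ p n) (hr : Tendsto (fun n => p n / a n) atTop (nhds c))
    (hlog : Tendsto (fun n : ℕ => Real.log (a n) / Real.log n) atTop (nhds (-1))) :
    Tendsto (fun n : ℕ => p n * Real.log (p n) ^ 2 / (a n * Real.log n ^ 2)) atTop (nhds c) := by
  have hL : Tendsto (fun n : ℕ => (Real.log n)⁻¹) atTop (nhds 0) :=
    (Real.tendsto_log_atTop.comp tendsto_natCast_atTop_atTop).inv_tendsto_atTop
  have h1 := (Real.continuous_mul_log.tendsto c).comp hr
  have h2 := (continuous_mul_log_sq.tendsto c).comp hr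
  have h := ((h2.mul (hL.pow 2)).add (((h1.mul hL).mul hlog).const_mul 2)).add
    (hr.mul (hlog.pow 2))
  have hlim : |c| * Real.log c ^ 2 * 0 ^ 2 + 2 * (c * Real.log c * 0 * -1) + c * (-1) ^ 2 = c := by
    ring
  rw [hlim] at h
  refine h.congr fun n => ?_
  have ha := (hapos n).ne'
  obtain hp | hp := eq_or_ne (p n) 0
  · simp [hp]
  simp only [Function.comp, Real.log_div hp ha,
    abs_of_nonneg (div_nonneg (hp0 n) (hapos n).le)]
  obtain hl | hl := eq_or_ne (Real.log n) 0
  · simp [hl]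
  field_simp
  ring

lemma abs_log_one_sub_le {x : ℝ} (h0 : 0 ≤ x) (h1 : x ≤ 1 / 2) :
    |Real.log (1 - x)| ≤ 2 * x := by
  have hpos : 0 < 1 - x := by linarith
  rw [abs_of_nonpos (Real.log_nonpos hpos.le (by linarith))]
  have h := Real.one_sub_inv_le_log_of_pos hpos
  have h2 : (1 - x)⁻¹ ≤ 1 + 2 * x := by
    rw [inv_le_iff_one_le_mul₀ hpos]
    nlinarith
  linarith

lemma tendsto_zero_of_log_ratio {a : ℕ → ℝ} (hapos : ∀ n, 0 < a n)
    (hlog : Tendsto (fun n : ℕ => Real.log (a n) / Real.log n) atTop (nhds (-1))) :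
    Tendsto a atTop (nhds 0) := by
  have hL : Tendsto (fun n : ℕ => Real.log n) atTop atTop :=
    Real.tendsto_log_atTop.comp tendsto_natCast_atTop_atTop
  have h := Real.tendsto_exp_atBot.comp (hlog.neg_mul_atTop (by norm_num) hL)
  refine h.congr' ?_
  filter_upwards [hL.eventually_gt_atTop 0] with n hn
  simp only [Function.comp]
  rw [div_mul_cancel₀ _ hn.ne', Real.exp_log (hapos n)]

end CRG

/-- **AEP for networked structures, near-sparse regime** (Theorem 2.2).
If `X` is a coloured random graph with colour law `μ : 𝒳 → (0,1]` and connection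
probabilities `p_n` with `aₙ⁻¹ pₙ(a,b) → C(a,b)`, where `aₙ n log n → ∞` and
`log aₙ / log n → −1`, then for every `ε > 0`,
`ℙ_n{ |−(1/(aₙ n² log n)) log P_n(X) − ½ Σ_{a,b} μ(a)C(a,b)μ(b)| ≥ ε } → 0`. -/
theorem aep_networked_sparse
    {𝒳 : Type} [Fintype 𝒳] [DecidableEq 𝒳] [Nonempty 𝒳]
    (μ : 𝒳 → ℝ) (hμ0 : ∀ a, 0 < μ a) (hμ1 : ∀ a, μ a ≤ 1) (hμs : ∑ a, μ a = 1)
    (p : ℕ → 𝒳 → 𝒳 → ℝ) (hp0 : ∀ n a b, 0 ≤ p n a b) (hp1 : ∀ n a b, p n a b ≤ 1)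
    (hpsymm : ∀ n a b, p n a b = p n b a)
    (C : 𝒳 → 𝒳 → ℝ) (hC0 : ∀ a b, 0 ≤ C a b) (hCsymm : ∀ a b, C a b = C b a)
    (a : ℕ → ℝ) (hapos : ∀ n, 0 < a n)
    (hconv : ∀ i j, Filter.Tendsto (fun n => p n i j / a n) Filter.atTop (nhds (C i j)))
    (hgrow : Filter.Tendsto (fun n : ℕ => a n * n * Real.log n) Filter.atTop Filter.atTop)
    (hlog : Filter.Tendsto (fun n : ℕ => Real.log (a n) / Real.log n) Filter.atTop (nhds (-1))) :
    ∀ ε > 0, Filter.Tendsto (fun n : ℕ => graphPr μ (p n) n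
      {x | ε ≤ |(-(1 / (a n * (n:ℝ)^2 * Real.log n)) * Real.log (graphWeight μ (p n) n x))
            - (1/2) * ∑ q : 𝒳 × 𝒳, μ q.1 * C q.1 q.2 * μ q.2|})
      Filter.atTop (nhds 0) := by
  intro ε hε
  have hL : Tendsto (fun n : ℕ => Real.log n) atTop atTop :=
    Real.tendsto_log_atTop.comp tendsto_natCast_atTop_atTop
  have hninv : Tendsto (fun n : ℕ => 1 / (n : ℝ)) atTop (nhds 0) :=
    tendsto_one_div_atTop_nhds_zero_nat
  have ha0 := tendsto_zero_of_log_ratio hapos hlog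
  obtain ⟨K, hK⟩ : ∃ K, ∀ i j, C i j < K := by
    refine ⟨(∑ q : 𝒳 × 𝒳, C q.1 q.2) + 1, fun i j => ?_⟩
    have := Finset.single_le_sum (f := fun q : 𝒳 × 𝒳 => C q.1 q.2) (fun q _ => hC0 _ _)
      (Finset.mem_univ (i, j))
    simp only at this
    linarith
  have hK0 : 0 < K := (hC0 _ _).trans_lt (hK (Classical.arbitrary 𝒳) (Classical.arbitrary 𝒳))
  obtain ⟨M, hM⟩ : ∃ M, ∀ i, |Real.log (μ i)| ≤ M :=
    ⟨∑ i, |Real.log (μ i)|, fun i =>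
      Finset.single_le_sum (f := fun i => |Real.log (μ i)|) (fun i _ => abs_nonneg _)
        (Finset.mem_univ i)⟩
  have hratio : ∀ᶠ n in atTop, ∀ i j, p n i j / a n < K :=
    eventually_all.2 fun i => eventually_all.2 fun j => (hconv i j).eventually_lt_const (hK i j)
  have hvar : ∀ᶠ n : ℕ in atTop, ∀ i j,
      p n i j * Real.log (p n i j) ^ 2 / (a n * Real.log n ^ 2) < K :=
    eventually_all.2 fun i => eventually_all.2 fun j =>
      (tendsto_mul_log_sq_of_ratio hapos (fun n => hp0 n i j) (hconv i j) hlog).eventually_lt_const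
        (hK i j)
  have hmean : ∀ᶠ n : ℕ in atTop, ∀ i j,
      |p n i j * Real.log (p n i j) / (a n * Real.log n) + C i j| < ε / 4 := by
    refine eventually_all.2 fun i => eventually_all.2 fun j => ?_
    have h := ((tendsto_mul_log_of_ratio hapos (hconv i j) hlog).add_const (C i j)).abs
    rw [neg_add_cancel, abs_zero] at h
    exact h.eventually_lt_const (by positivity)
  have hsmallp : ∀ᶠ n in atTop, a n * K < 1 / 2 := by
    have h := ha0.mul_const K
    rw [zero_mul] at h
    exact h.eventually_lt_const (by norm_num)
  have herr : ∀ᶠ n : ℕ in atTop,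
      M * (a n * n * Real.log n)⁻¹ + 2 * K * (Real.log n)⁻¹ + K * (1 / n) < ε / 4 := by
    have h := ((hgrow.inv_tendsto_atTop.const_mul M).add
      (hL.inv_tendsto_atTop.const_mul (2 * K))).add (hninv.const_mul K)
    simp only [mul_zero, add_zero] at h
    exact h.eventually_lt_const (by positivity)
  have hsq : Tendsto (fun n : ℕ => a n * (n : ℝ) ^ 2) atTop atTop := by
    refine tendsto_atTop_mono (fun n => ?_) hgrow
    rw [sq, ← mul_assoc]
    exact mul_le_mul_of_nonneg_left (Real.log_le_self (Nat.cast_nonneg n))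
      (mul_nonneg (hapos n).le (Nat.cast_nonneg n))
  have hbound : Tendsto (fun n : ℕ => 8 / ε ^ 2 * (K * (a n * (n : ℝ) ^ 2)⁻¹
      + (K * Fintype.card 𝒳) ^ 2 * Fintype.card 𝒳 * (Fintype.card 𝒳 * (1 / n))))
      atTop (nhds 0) := by
    have h := ((hsq.inv_tendsto_atTop.const_mul K).add ((hninv.const_mul
      (Fintype.card 𝒳 : ℝ)).const_mul ((K * Fintype.card 𝒳) ^ 2 * Fintype.card 𝒳))).const_mul
      (8 / ε ^ 2)
    simp only [mul_zero, add_zero] at h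
    exact h
  refine squeeze_zero' (Eventually.of_forall fun n => Finset.sum_nonneg fun x _ =>
    Set.indicator_nonneg
      (fun x _ => graphWeight_nonneg (fun i => (hμ0 i).le) (hp0 n) (hp1 n) n x) x) ?_ hbound
  filter_upwards [hratio, hvar, hmean, hsmallp, herr, hL.eventually_gt_atTop 0,
    eventually_gt_atTop 0] with n hratio hvar hmean hsmallp herr hlogn hn
  have han := hapos n
  have hn' : (0 : ℝ) < n := by exact_mod_cast hn
  have hp : ∀ i j, p n i j ≤ a n * K := fun i j =>
    ((div_lt_iff₀' han).1 (hratio i j)).le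
  refine (graphPr_log_graphWeight_le (K := K) (M := M) (m := 2 * (a n * K)) (η := ε / 4)
    (B := K * (a n * Real.log n ^ 2)) (fun i => (hμ0 i).le) hμs (hp0 n) (hp1 n) hCsymm
    (fun i j => by rw [abs_of_nonneg (hC0 i j)]; exact (hK i j).le) hM (by positivity)
    (fun i j => (abs_log_one_sub_le (hp0 n i j) ((hp i j).trans hsmallp.le)).trans
      (by linarith [hp i j])) hn (by positivity) (by positivity)
    (fun i j => ?_) (by positivity) (fun i j => ?_) hε ?_).trans (le_of_eq ?_)
  · convert! (hmean i j).le using 3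
    field_simp
  · exact ((div_lt_iff₀ (by positivity)).1 (hvar i j)).le
  · have h : n * M / (a n * (n : ℝ) ^ 2 * Real.log n) + ε / 4
        + (n : ℝ) ^ 2 * (2 * (a n * K)) / (a n * (n : ℝ) ^ 2 * Real.log n) + K / n
        = M * (a n * n * Real.log n)⁻¹ + 2 * K * (Real.log n)⁻¹ + K * (1 / n) + ε / 4 := by
      field_simp
      ring
    linarith
  · congr 2
    field_simp
end
end
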